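/- arXiv:1404.5892 — 2 statements merged into one kernel-verified Lean document; each statement's English description precedes it below -/
import Mathlib

section
/- In every planar y-monotone poly-line drawing of the complete bipartite graph K_{2,5} of height 3 (all vertices and bends have integer y-coordinates in {1,2,3}), one of the two vertices of the part of size 2 has y-coordinate 1 and the other has y-coordinate 3. -/
open Set

noncomputable section

/-- Points of the plane. -/
abbrev Pt : Type := ℝ × ℝ

/-- The image (set of points) of a polygonal chain given by its list of breakpoints. -/
def chainSet : List Pt → Set Pt
  | [] => ∅
  | [p] => {p}
  | p :: q :: rest => segment ℝ p q ∪ chainSet (q :: rest)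

/-- The bends (interior junction points) of a polygonal chain. -/
def chainBends (l : List Pt) : List Pt := (l.drop 1).dropLast

/-- `S` is the image of a simple (injective) curve from `a` to `b`. -/
def IsSimpleArc (S : Set Pt) (a b : Pt) : Prop :=
  ∃ γ : ℝ → Pt, ContinuousOn γ (Icc (0:ℝ) 1) ∧ InjOn γ (Icc (0:ℝ) 1) ∧
    γ '' Icc (0:ℝ) 1 = S ∧ γ 0 = a ∧ γ 1 = b

/-- A poly-line drawing of a simple graph `G`: an injective placement of the vertices
together with, for each edge, a simple polygonal arc joining the endpoints. -/
structure PolyDrawing {V : Type} (G : SimpleGraph V) where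
  pos : V → Pt
  pos_inj : Function.Injective pos
  arc : Sym2 V → List Pt
  arc_ends : ∀ u v : V, G.Adj u v →
    ((arc s(u, v)).head? = some (pos u) ∧ (arc s(u, v)).getLast? = some (pos v)) ∨
    ((arc s(u, v)).head? = some (pos v) ∧ (arc s(u, v)).getLast? = some (pos u))
  arc_simple : ∀ u v : V, G.Adj u v →
    IsSimpleArc (chainSet (arc s(u, v))) (pos u) (pos v)

namespace PolyDrawing

variable {V : Type} {G : SimpleGraph V}

/-- The set of points used by the arc of an edge. -/
def edgePts (Γ : PolyDrawing G) (e : Sym2 V) : Set Pt := chainSet (Γ.arc e)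

/-- Planarity: no vertex point lies on the arc of a non-incident edge, and arcs of
distinct edges meet only in images of common endpoints. -/
def IsPlanar (Γ : PolyDrawing G) : Prop :=
  (∀ v : V, ∀ e ∈ G.edgeSet, v ∉ e → Γ.pos v ∉ Γ.edgePts e) ∧
  (∀ e ∈ G.edgeSet, ∀ f ∈ G.edgeSet, e ≠ f →
    ∀ p ∈ Γ.edgePts e ∩ Γ.edgePts f, ∃ w : V, w ∈ e ∧ w ∈ f ∧ p = Γ.pos w)

/-- `y`-monotone: along every edge arc the `y`-coordinate varies weakly monotonically. -/
def IsYMonotone (Γ : PolyDrawing G) : Prop :=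
  ∀ e ∈ G.edgeSet,
    List.Chain' (· ≤ ·) ((Γ.arc e).map Prod.snd) ∨
    List.Chain' (· ≥ ·) ((Γ.arc e).map Prod.snd)

/-- The drawing has height `h`: every vertex and every bend has an integer
`y`-coordinate in `{1, …, h}`. -/
def HasHeight (Γ : PolyDrawing G) (h : ℕ) : Prop :=
  (∀ v : V, ∃ k : ℤ, 1 ≤ k ∧ k ≤ (h : ℤ) ∧ (Γ.pos v).2 = (k : ℝ)) ∧
  (∀ e ∈ G.edgeSet, ∀ p ∈ chainBends (Γ.arc e), ∃ k : ℤ, 1 ≤ k ∧ k ≤ (h : ℤ) ∧ p.2 = (k : ℝ))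

/-- All vertices and bends have integer `y`-coordinates. -/
def IntegerY (Γ : PolyDrawing G) : Prop :=
  (∀ v : V, ∃ k : ℤ, (Γ.pos v).2 = (k : ℝ)) ∧
  (∀ e ∈ G.edgeSet, ∀ p ∈ chainBends (Γ.arc e), ∃ k : ℤ, p.2 = (k : ℝ))

/-- The set of all points of the drawing (vertex points and edge arcs). -/
def image (Γ : PolyDrawing G) : Set Pt :=
  Set.range Γ.pos ∪ ⋃ e ∈ G.edgeSet, Γ.edgePts e

/-- The union of the unbounded connected components of the complement of the drawing. -/
def outerRegion (Γ : PolyDrawing G) : Set Pt :=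
  {p | p ∉ Γ.image ∧ ¬ Bornology.IsBounded (connectedComponentIn Γ.imageᶜ p)}

/-- A vertex is inner if its point does not lie on the boundary of the unbounded
connected component of the complement of the drawing. -/
def IsInner (Γ : PolyDrawing G) (v : V) : Prop :=
  Γ.pos v ∉ frontier Γ.outerRegion

/-- Number of incoming edges at `v` (edges whose other endpoint is weakly below `v`;
horizontal edges count as incoming). -/
def indeg (Γ : PolyDrawing G) (v : V) : ℕ :=
  {w : V | G.Adj v w ∧ (Γ.pos w).2 ≤ (Γ.pos v).2}.ncard

/-- Number of outgoing edges at `v` (edges whose other endpoint is weakly above `v`;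
horizontal edges count as outgoing). -/
def outdeg (Γ : PolyDrawing G) (v : V) : ℕ :=
  {w : V | G.Adj v w ∧ (Γ.pos v).2 ≤ (Γ.pos w).2}.ncard

/-- The set of points drawn for an element (vertex or edge) of the graph. -/
def drawSet (Γ : PolyDrawing G) : V ⊕ ↥G.edgeSet → Set Pt
  | Sum.inl v => {Γ.pos v}
  | Sum.inr e => Γ.edgePts e

end PolyDrawing

/-- A straight-line drawing of a simple graph: an injective placement of the vertices;
each edge is drawn as the closed segment between its endpoints. -/
structure StraightDrawing {V : Type} (G : SimpleGraph V) where
  pos : V → Pt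
  pos_inj : Function.Injective pos

namespace StraightDrawing

variable {V : Type} {G : SimpleGraph V}

/-- The closed segment representing an edge. -/
def edgePts (Γ : StraightDrawing G) (e : Sym2 V) : Set Pt :=
  Sym2.lift ⟨fun u v => segment ℝ (Γ.pos u) (Γ.pos v),
    fun u v => segment_symm (𝕜 := ℝ) (Γ.pos u) (Γ.pos v)⟩ e

/-- Planarity of a straight-line drawing. -/
def IsPlanar (Γ : StraightDrawing G) : Prop :=
  (∀ v : V, ∀ e ∈ G.edgeSet, v ∉ e → Γ.pos v ∉ Γ.edgePts e) ∧
  (∀ e ∈ G.edgeSet, ∀ f ∈ G.edgeSet, e ≠ f →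
    ∀ p ∈ Γ.edgePts e ∩ Γ.edgePts f, ∃ w : V, w ∈ e ∧ w ∈ f ∧ p = Γ.pos w)

/-- Every vertex has an integer `y`-coordinate in `{1, …, h}`. -/
def HeightLe (Γ : StraightDrawing G) (h : ℕ) : Prop :=
  ∀ v : V, ∃ k : ℤ, 1 ≤ k ∧ k ≤ (h : ℤ) ∧ (Γ.pos v).2 = (k : ℝ)

/-- All vertices lie on integer grid points. -/
def IsGrid (Γ : StraightDrawing G) : Prop :=
  ∀ v : V, ∃ p : ℤ × ℤ, Γ.pos v = ((p.1 : ℝ), (p.2 : ℝ))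

/-- The set of points drawn for an element (vertex or edge) of the graph. -/
def drawSet (Γ : StraightDrawing G) : V ⊕ ↥G.edgeSet → Set Pt
  | Sum.inl v => {Γ.pos v}
  | Sum.inr e => Γ.edgePts e

end StraightDrawing

/-- The intersection of a set of points with the horizontal line `y = r`,
recorded as a set of `x`-coordinates. -/
def rowSlice (S : Set Pt) (r : ℝ) : Set ℝ := {x : ℝ | (x, r) ∈ S}

/-- Two drawings (given by the sets drawn for each vertex/edge element) have the same
left-to-right order in each row: for every integer row `r` and elements `a`, `b` both
meeting row `r` in both drawings, the drawing of `a` lies entirely strictly to the left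
of that of `b` in one drawing iff it does in the other. -/
def SameRowOrder {α : Type} (D D' : α → Set Pt) : Prop :=
  ∀ r : ℤ, ∀ a b : α,
    (rowSlice (D a) (r : ℝ)).Nonempty → (rowSlice (D b) (r : ℝ)).Nonempty →
    (rowSlice (D' a) (r : ℝ)).Nonempty → (rowSlice (D' b) (r : ℝ)).Nonempty →
    ((∀ x ∈ rowSlice (D a) (r : ℝ), ∀ y ∈ rowSlice (D b) (r : ℝ), x < y) ↔
     (∀ x ∈ rowSlice (D' a) (r : ℝ), ∀ y ∈ rowSlice (D' b) (r : ℝ), x < y))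

/-- A simple graph on `n ≥ 3` vertices is triangulated (maximal planar) if it admits a
planar poly-line drawing and has exactly `3n - 6` edges. -/
def IsTriangulated {V : Type} [Fintype V] (G : SimpleGraph V) : Prop :=
  3 ≤ Fintype.card V ∧ G.edgeSet.ncard = 3 * Fintype.card V - 6 ∧
  ∃ Γ : PolyDrawing G, Γ.IsPlanar

/-- Data of a flat visibility representation: a horizontal segment for every vertex
(given by its `y`-coordinate and left/right `x`-coordinates) and a segment (given by
its two endpoints) for every edge. -/
structure VisData (V : Type) where
  ly : V → ℝ
  lx : V → ℝ
  rx : V → ℝ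
  ep1 : Sym2 V → Pt
  ep2 : Sym2 V → Pt

/-- The horizontal segment of a vertex. -/
def VisData.vseg {V : Type} (D : VisData V) (v : V) : Set Pt :=
  segment ℝ (D.lx v, D.ly v) (D.rx v, D.ly v)

/-- The segment of an edge. -/
def VisData.eseg {V : Type} (D : VisData V) (e : Sym2 V) : Set Pt :=
  segment ℝ (D.ep1 e) (D.ep2 e)

/-- `D` is a planar flat visibility representation of `G` of height `h`. -/
def IsFlatVisRep {V : Type} (G : SimpleGraph V) (D : VisData V) (h : ℕ) : Prop :=
  (∀ v : V, D.lx v ≤ D.rx v) ∧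
  (∀ v : V, ∃ k : ℤ, 1 ≤ k ∧ k ≤ (h : ℤ) ∧ D.ly v = (k : ℝ)) ∧
  (∀ e ∈ G.edgeSet, (D.ep1 e).1 = (D.ep2 e).1 ∨ (D.ep1 e).2 = (D.ep2 e).2) ∧
  (∀ e ∈ G.edgeSet, ∀ p ∈ D.eseg e, 1 ≤ p.2 ∧ p.2 ≤ (h : ℝ)) ∧
  (∀ u v : V, G.Adj u v →
    (D.ep1 s(u, v) ∈ D.vseg u ∧ D.ep2 s(u, v) ∈ D.vseg v) ∨
    (D.ep1 s(u, v) ∈ D.vseg v ∧ D.ep2 s(u, v) ∈ D.vseg u)) ∧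
  (∀ u v : V, u ≠ v → Disjoint (D.vseg u) (D.vseg v)) ∧
  (∀ e ∈ G.edgeSet, ∀ w : V, ∀ p ∈ D.eseg e ∩ D.vseg w, p = D.ep1 e ∨ p = D.ep2 e) ∧
  (∀ e ∈ G.edgeSet, ∀ f ∈ G.edgeSet, e ≠ f → ∀ p ∈ D.eseg e ∩ D.eseg f,
    (p = D.ep1 e ∨ p = D.ep2 e) ∧ (p = D.ep1 f ∨ p = D.ep2 f))

end

lemma ordConnected_rowSlice_segment (p q : Pt) (r : ℝ) :
    (rowSlice (segment ℝ p q) r).OrdConnected := by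
  apply Convex.ordConnected
  intro x hx y hy a b ha hb hab
  have h := (convex_segment (𝕜 := ℝ) p q) hx hy ha hb hab
  have hr : a * r + b * r = r := by rw [← add_mul, hab, one_mul]
  simpa [rowSlice, hr] using h

lemma left_mem_chainSet (q : Pt) (l : List Pt) : q ∈ chainSet (q :: l) := by
  cases l with
  | nil => simp [chainSet]
  | cons r l => exact Or.inl (left_mem_segment ℝ q r)

lemma mul_snd_bounds_of_mem_segment {σ : ℝ} {p q z : Pt} (hpq : σ * p.2 ≤ σ * q.2)
    (hz : z ∈ segment ℝ p q) : σ * p.2 ≤ σ * z.2 ∧ σ * z.2 ≤ σ * q.2 := by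
  obtain ⟨a, b, ha, hb, hab, rfl⟩ := hz
  obtain rfl : a = 1 - b := by linarith
  simp only [Prod.snd_add, Prod.smul_snd, smul_eq_mul]
  constructor <;> nlinarith

/-- A chain that is monotone in the direction `σ` stays on one side of its first point. -/
lemma mul_snd_head_le {σ : ℝ} (l : List Pt) (q : Pt)
    (h : (q :: l).IsChain (fun a b => σ * a.2 ≤ σ * b.2)) {z : Pt}
    (hz : z ∈ chainSet (q :: l)) : σ * q.2 ≤ σ * z.2 := by
  induction l generalizing q with
  | nil =>
    obtain rfl : z = q := hz
    exact le_rfl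
  | cons r l ih =>
    rw [List.isChain_cons_cons] at h
    rcases hz with hz | hz
    · exact (mul_snd_bounds_of_mem_segment h.1 hz).1
    · exact h.1.trans (ih r h.2 hz)

lemma ordConnected_rowSlice_chainSet {σ : ℝ} (hσ : σ ≠ 0) (l : List Pt)
    (h : l.IsChain (fun a b => σ * a.2 ≤ σ * b.2)) (r : ℝ) :
    (rowSlice (chainSet l) r).OrdConnected := by
  induction l with
  | nil => exact ordConnected_empty
  | cons p l ih =>
    cases l with
    | nil =>
      have : chainSet [p] = segment ℝ p p := by simp [chainSet]
      rw [this]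
      exact ordConnected_rowSlice_segment p p r
    | cons q l =>
      rw [List.isChain_cons_cons] at h
      have hs := ordConnected_rowSlice_segment p q r
      have ht := ih h.2
      change (rowSlice (segment ℝ p q) r ∪ rowSlice (chainSet (q :: l)) r).OrdConnected
      by_cases hr : r = q.2
      · subst hr
        rw [← isPreconnected_iff_ordConnected] at hs ht ⊢
        exact hs.union q.1 (right_mem_segment ℝ p q) (left_mem_chainSet q l) ht
      · rcases (rowSlice (segment ℝ p q) r).eq_empty_or_nonempty with he | ⟨x, hx⟩
        · rwa [he, empty_union]
        rcases (rowSlice (chainSet (q :: l)) r).eq_empty_or_nonempty with he | ⟨y, hy⟩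
        · rwa [he, union_empty]
        exact absurd (mul_left_cancel₀ hσ
          (le_antisymm (mul_snd_bounds_of_mem_segment (z := (x, r)) h.1 hx).2
            (mul_snd_head_le (z := (y, r)) l q h.2 hy))) hr

/-- A compact set meeting every row between the rows of `p` and `q`, each of them in an interval,
and containing `p` and `q`. -/
structure IsRowArc (S : Set Pt) (p q : Pt) : Prop where
  isCompact : IsCompact S
  left_mem : p ∈ S
  right_mem : q ∈ S
  ordConnected (r : ℝ) : (rowSlice S r).OrdConnected
  nonempty {r : ℝ} (hr : r ∈ uIcc p.2 q.2) : (rowSlice S r).Nonempty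

lemma PolyDrawing.IsYMonotone.isRowArc {V : Type} {G : SimpleGraph V} {Γ : PolyDrawing G}
    (hmono : Γ.IsYMonotone) {u v : V} (h : G.Adj u v) :
    IsRowArc (Γ.edgePts s(u, v)) (Γ.pos u) (Γ.pos v) := by
  obtain ⟨γ, hγ, -, himg, h0, h1⟩ := Γ.arc_simple u v h
  change γ '' Icc 0 1 = Γ.edgePts s(u, v) at himg
  have hu : Γ.pos u ∈ Γ.edgePts s(u, v) := himg ▸ ⟨0, by simp, h0⟩
  have hv : Γ.pos v ∈ Γ.edgePts s(u, v) := himg ▸ ⟨1, by simp, h1⟩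
  refine ⟨himg ▸ isCompact_Icc.image_of_continuousOn hγ, hu, hv, fun r => ?_, fun {r} hr => ?_⟩
  · rcases hmono s(u, v) h with hc | hc <;> rw [List.Chain', List.isChain_map] at hc
    · exact ordConnected_rowSlice_chainSet (σ := 1) one_ne_zero _ (by simpa using hc) r
    · exact ordConnected_rowSlice_chainSet (σ := -1) (by norm_num) _ (by simpa using hc) r
  · have hpre : IsPreconnected (Prod.snd '' Γ.edgePts s(u, v)) :=
      (himg ▸ isPreconnected_Icc.image γ hγ).image _ continuous_snd.continuousOn
    obtain ⟨z, hz, rfl⟩ := hpre.ordConnected.uIcc_subset ⟨_, hu, rfl⟩ ⟨_, hv, rfl⟩ hr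
    exact ⟨z.1, hz⟩

lemma lt_of_disjoint_rowSlice {S T : Set ℝ} (hS : S.OrdConnected) (hT : T.OrdConnected)
    (hd : Disjoint S T) {x x' y y' : ℝ} (hx : x ∈ S) (hy : y ∈ T) (hxy : x ≤ y)
    (hx' : x' ∈ S) (hy' : y' ∈ T) : x' < y' := by
  rw [Set.disjoint_left] at hd
  by_contra! hlt
  rcases le_total y x' with h | h
  · exact hd (hS.out hx hx' ⟨hxy, h⟩) hy
  · exact hd hx' (hT.out hy' hy ⟨hlt, h⟩)

lemma isClosed_rows_le {S T : Set Pt} (hS : IsCompact S) (hT : IsCompact T) :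
    IsClosed {t : ℝ | ∃ x ∈ rowSlice S t, ∃ y ∈ rowSlice T t, x ≤ y} := by
  have hK : IsCompact ((S ×ˢ T) ∩ {z : Pt × Pt | z.1.2 = z.2.2 ∧ z.1.1 ≤ z.2.1}) := by
    apply (hS.prod hT).inter_right
    exact (isClosed_eq (f := fun z : Pt × Pt => z.1.2) (g := fun z => z.2.2)
      (by fun_prop) (by fun_prop)).inter
        (isClosed_le (f := fun z : Pt × Pt => z.1.1) (g := fun z => z.2.1)
          (by fun_prop) (by fun_prop))
  convert (hK.image (f := fun z : Pt × Pt => z.1.2) (by fun_prop)).isClosed using 1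
  ext t
  constructor
  · rintro ⟨x, hx, y, hy, hxy⟩
    exact ⟨((x, t), (y, t)), ⟨⟨hx, hy⟩, rfl, hxy⟩, rfl⟩
  · rintro ⟨⟨⟨x, t⟩, ⟨y, t'⟩⟩, ⟨⟨hx, hy⟩, ht, hxy⟩, rfl⟩
    obtain rfl : t = t' := ht
    exact ⟨x, hx, y, hy, hxy⟩

/-- Disjoint row arcs have the same left-to-right order in all rows met by both. -/
lemma IsRowArc.lt_of_lt {S T : Set Pt} {p q p' q' : Pt} (hS : IsRowArc S p q)
    (hT : IsRowArc T p' q') (hd : Disjoint S T) {r s x y x' y' : ℝ}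
    (hrS : r ∈ uIcc p.2 q.2) (hrT : r ∈ uIcc p'.2 q'.2)
    (hsS : s ∈ uIcc p.2 q.2) (hsT : s ∈ uIcc p'.2 q'.2)
    (hx : x ∈ rowSlice S r) (hy : y ∈ rowSlice T r) (hxy : x < y)
    (hx' : x' ∈ rowSlice S s) (hy' : y' ∈ rowSlice T s) : x' < y' := by
  by_contra! hlt
  have hrow (t : ℝ) : Disjoint (rowSlice S t) (rowSlice T t) :=
    Set.disjoint_left.2 fun _ h h' => Set.disjoint_left.1 hd h h'
  have hcover : uIcc r s ⊆ {t : ℝ | ∃ x ∈ rowSlice S t, ∃ y ∈ rowSlice T t, x ≤ y} ∪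
      {t : ℝ | ∃ y ∈ rowSlice T t, ∃ x ∈ rowSlice S t, y ≤ x} := by
    intro t ht
    obtain ⟨u, hu⟩ := hS.nonempty (uIcc_subset_uIcc hrS hsS ht)
    obtain ⟨v, hv⟩ := hT.nonempty (uIcc_subset_uIcc hrT hsT ht)
    exact (le_total u v).imp (fun h => ⟨u, hu, v, hv, h⟩) (fun h => ⟨v, hv, u, hu, h⟩)
  obtain ⟨t, -, ⟨u, hu, v, hv, huv⟩, ⟨v', hv', u', hu', hvu⟩⟩ :=
    isPreconnected_closed_iff.1 isPreconnected_uIcc _ _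
      (isClosed_rows_le hS.isCompact hT.isCompact) (isClosed_rows_le hT.isCompact hS.isCompact)
      hcover ⟨r, left_mem_uIcc, x, hx, y, hy, hxy.le⟩ ⟨s, right_mem_uIcc, y', hy', x', hx', hlt⟩
  exact (lt_of_disjoint_rowSlice (hS.ordConnected t) (hT.ordConnected t) (hrow t)
    hu hv huv hu' hv').not_ge hvu

/-- The point `b` lies to the left of every point of `S` in its row. -/
def PassesRight (b : Pt) (S : Set Pt) : Prop := ∀ x ∈ rowSlice S b.2, b.1 < x

/-- An arc avoiding `b` meets the row of `b` on one side of `b` only. -/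
lemma IsRowArc.lt_of_not_passesRight {S : Set Pt} {p q b : Pt} (hS : IsRowArc S p q) (hb : b ∉ S)
    (h : ¬ PassesRight b S) {x : ℝ} (hx : x ∈ rowSlice S b.2) : x < b.1 := by
  simp only [PassesRight, not_forall, not_lt] at h
  obtain ⟨y, hy, hyb⟩ := h
  exact lt_of_disjoint_rowSlice (hS.ordConnected b.2) ordConnected_singleton
    (disjoint_singleton_right.2 hb) hy rfl hyb hx rfl

/-- The geometric content of a planar `y`-monotone drawing of `K_{2,n}`: hubs `a` and `b`, leaves
`c i`, and arcs `A i` from `a` to `c i` and `B i` from `b` to `c i`. -/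
structure IsTwoHub {ι : Type} (a b : Pt) (c : ι → Pt) (A B : ι → Set Pt) : Prop where
  hub_ne : a ≠ b
  left_arc (i : ι) : IsRowArc (A i) a (c i)
  right_arc (i : ι) : IsRowArc (B i) b (c i)
  left_notMem (i : ι) : b ∉ A i
  right_notMem (i : ι) : a ∉ B i
  disj {i j : ι} (hij : i ≠ j) : Disjoint (A i) (B j)

namespace IsTwoHub

variable {ι : Type} {a b : Pt} {c : ι → Pt} {A B : ι → Set Pt}

lemma swap (h : IsTwoHub a b c A B) : IsTwoHub b a c B A :=
  ⟨h.hub_ne.symm, h.right_arc, h.left_arc, h.right_notMem, h.left_notMem,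
    fun hij => (h.disj hij.symm).symm⟩

/-- Leaves in one row are ordered like the two hubs, if the hubs are ordered by a row. -/
lemma leaf_lt (h : IsTwoHub a b c A B) {i j : ι} (hij : i ≠ j) (hrow : (c i).2 = (c j).2)
    {r x y : ℝ} (hA : r ∈ uIcc a.2 (c i).2) (hB : r ∈ uIcc b.2 (c i).2)
    (hx : x ∈ rowSlice (A i) r) (hy : y ∈ rowSlice (B j) r) (hxy : x < y) :
    (c i).1 < (c j).1 := by
  refine (h.left_arc i).lt_of_lt (h.right_arc j) (h.disj hij) hA (hrow ▸ hB)
    (s := (c i).2) right_mem_uIcc (hrow ▸ right_mem_uIcc) hx hy hxy (h.left_arc i).right_mem ?_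
  rw [hrow]
  exact (h.right_arc j).right_mem

lemma lt_leaf (h : IsTwoHub a b c A B) {i j : ι} (hij : i ≠ j) (hrow : (c i).2 = (c j).2)
    {r x y : ℝ} (hA : r ∈ uIcc a.2 (c i).2) (hB : r ∈ uIcc b.2 (c i).2)
    (hx : x ∈ rowSlice (A i) r) (hy : y ∈ rowSlice (B j) r) (hxy : y < x) :
    (c j).1 < (c i).1 :=
  h.swap.leaf_lt hij.symm hrow.symm (hrow ▸ hB) (hrow ▸ hA) hy hx hxy

/-- With both hubs in one row, all leaves lie in different rows. -/
lemma leaf_row_ne (h : IsTwoHub a b c A B) (hab : a.2 = b.2) {i j : ι} (hij : i ≠ j) :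
    (c i).2 ≠ (c j).2 := by
  intro hrow
  have hA (k : ι) : a.1 ∈ rowSlice (A k) a.2 := (h.left_arc k).left_mem
  have hB (k : ι) : b.1 ∈ rowSlice (B k) a.2 := hab ▸ (h.right_arc k).left_mem
  have hl (k : ι) : a.2 ∈ uIcc a.2 (c k).2 := left_mem_uIcc
  have hr (k : ι) : a.2 ∈ uIcc b.2 (c k).2 := hab ▸ left_mem_uIcc
  rcases lt_trichotomy a.1 b.1 with hlt | heq | hlt
  · exact lt_asymm (h.leaf_lt hij hrow (hl i) (hr i) (hA i) (hB j) hlt)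
      (h.leaf_lt hij.symm hrow.symm (hl j) (hr j) (hA j) (hB i) hlt)
  · exact h.hub_ne (Prod.ext heq hab)
  · exact lt_asymm (h.lt_leaf hij hrow (hl i) (hr i) (hA i) (hB j) hlt)
      (h.lt_leaf hij.symm hrow.symm (hl j) (hr j) (hA j) (hB i) hlt)

/-- Two leaves of one row whose arcs from `a` pass the row of `b` do so on different sides. -/
lemma not_passesRight_iff (h : IsTwoHub a b c A B) {i j : ι} (hij : i ≠ j)
    (hrow : (c i).2 = (c j).2) (hb : b.2 ∈ uIcc a.2 (c i).2) :
    ¬ (PassesRight b (A i) ↔ PassesRight b (A j)) := by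
  intro hiff
  obtain ⟨x, hx⟩ := (h.left_arc i).nonempty hb
  obtain ⟨y, hy⟩ := (h.left_arc j).nonempty (hrow ▸ hb)
  have hB (k : ι) : b.1 ∈ rowSlice (B k) b.2 := (h.right_arc k).left_mem
  by_cases hi : PassesRight b (A i)
  · exact lt_asymm (h.lt_leaf hij hrow hb left_mem_uIcc hx (hB j) (hi x hx))
      (h.lt_leaf hij.symm hrow.symm (hrow ▸ hb) left_mem_uIcc hy (hB i) (hiff.1 hi y hy))
  · exact lt_asymm
      (h.leaf_lt hij hrow hb left_mem_uIcc hx (hB j)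
        ((h.left_arc i).lt_of_not_passesRight (h.left_notMem i) hi hx))
      (h.leaf_lt hij.symm hrow.symm (hrow ▸ hb) left_mem_uIcc hy (hB i)
        ((h.left_arc j).lt_of_not_passesRight (h.left_notMem j) (mt hiff.2 hi) hy))

/-- An arc from `b` passing `a` and an arc from `a` passing `b` do so on different sides. -/
lemma not_passesRight_iff_passesRight (h : IsTwoHub a b c A B) {i j : ι} (hij : i ≠ j)
    (ha : a.2 ∈ uIcc b.2 (c i).2) (hb : b.2 ∈ uIcc a.2 (c j).2) :
    ¬ (PassesRight a (B i) ↔ PassesRight b (A j)) := by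
  intro hiff
  obtain ⟨x, hx⟩ := (h.right_arc i).nonempty ha
  obtain ⟨y, hy⟩ := (h.left_arc j).nonempty hb
  have hA : a.1 ∈ rowSlice (A j) a.2 := (h.left_arc j).left_mem
  have hB : b.1 ∈ rowSlice (B i) b.2 := (h.right_arc i).left_mem
  have hd := h.disj hij.symm
  by_cases hi : PassesRight a (B i)
  · exact lt_asymm (hiff.1 hi y hy) ((h.left_arc j).lt_of_lt (h.right_arc i) hd
      left_mem_uIcc ha hb left_mem_uIcc hA hx (hi x hx) hy hB)
  · exact lt_asymm
      ((h.left_arc j).lt_of_not_passesRight (h.left_notMem j) (mt hiff.2 hi) hy)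
      ((h.right_arc i).lt_of_lt (h.left_arc j) hd.symm ha left_mem_uIcc left_mem_uIcc hb hx hA
        ((h.right_arc i).lt_of_not_passesRight (h.right_notMem i) hi hx) hB hy)

/-- In three rows, hubs in the middle row and in an outer row admit at most four leaves. -/
lemma false_of_middle [Fintype ι] (hcard : 4 < Fintype.card ι) (h : IsTwoHub a b c A B)
    (ha : a.2 = 1 ∨ a.2 = 3) (hb : b.2 = 2) (hc : ∀ i, (c i).2 = 1 ∨ (c i).2 = 2 ∨ (c i).2 = 3) :
    False := by
  classical
  let side (i : ι) : Prop := if (c i).2 = a.2 then PassesRight a (B i) else PassesRight b (A i)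
  have hbtw (i : ι) (hi : (c i).2 ≠ a.2) : b.2 ∈ uIcc a.2 (c i).2 := by
    rw [mem_uIcc, hb]
    grind
  obtain ⟨i, j, hij, heq⟩ := Fintype.exists_ne_map_eq_of_card_lt
    (fun i => (decide ((c i).2 = 4 - a.2), decide (side i))) (by simpa using hcard)
  simp only [Prod.mk.injEq, decide_eq_decide] at heq
  obtain ⟨hout, hside⟩ := heq
  by_cases hi : (c i).2 = a.2 <;> by_cases hj : (c j).2 = a.2 <;>
    simp only [side, hi, hj, if_true, if_false] at hside
  · exact h.swap.not_passesRight_iff hij (hi.trans hj.symm) (hi ▸ right_mem_uIcc) hside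
  · exact h.not_passesRight_iff_passesRight hij (hi ▸ right_mem_uIcc) (hbtw j hj) hside
  · exact h.not_passesRight_iff_passesRight hij.symm (hj ▸ right_mem_uIcc) (hbtw i hi) hside.symm
  · refine h.not_passesRight_iff hij ?_ (hbtw i hi) hside
    grind

end IsTwoHub

lemma PolyDrawing.IsPlanar.isTwoHub {n : ℕ}
    {Γ : PolyDrawing (completeBipartiteGraph (Fin 2) (Fin n))}
    (hpl : Γ.IsPlanar) (hmono : Γ.IsYMonotone) :
    IsTwoHub (Γ.pos (Sum.inl 0)) (Γ.pos (Sum.inl 1)) (fun i => Γ.pos (Sum.inr i))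
      (fun i => Γ.edgePts s(Sum.inl 0, Sum.inr i)) (fun i => Γ.edgePts s(Sum.inl 1, Sum.inr i)) := by
  have hadj (k : Fin 2) (i : Fin n) :
      (completeBipartiteGraph (Fin 2) (Fin n)).Adj (Sum.inl k) (Sum.inr i) := by simp
  refine ⟨fun heq => ?_, fun i => hmono.isRowArc (hadj 0 i), fun i => hmono.isRowArc (hadj 1 i),
    fun i => hpl.1 _ _ (hadj 0 i) (by simp), fun i => hpl.1 _ _ (hadj 1 i) (by simp),
    fun {i j} hij => Set.disjoint_left.2 fun p hp hp' => ?_⟩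
  · simpa using Γ.pos_inj heq
  · obtain ⟨w, hw, hw', -⟩ := hpl.2 _ (hadj 0 i) _ (hadj 1 j) (by simp) p ⟨hp, hp'⟩
    rw [Sym2.mem_iff] at hw hw'
    rcases hw with rfl | rfl <;> simp_all

lemma PolyDrawing.HasHeight.row {V : Type} {G : SimpleGraph V} {Γ : PolyDrawing G}
    (h : Γ.HasHeight 3) (v : V) : (Γ.pos v).2 = 1 ∨ (Γ.pos v).2 = 2 ∨ (Γ.pos v).2 = 3 := by
  obtain ⟨k, h1, h3, hk⟩ := h.1 v
  push_cast at h3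
  rw [hk]
  interval_cases k <;> norm_num

/-- In every planar `y`-monotone poly-line drawing of `K_{2,5}` of
height 3, one of the two vertices of the part of size 2 has `y`-coordinate 1 and the
other has `y`-coordinate 3. -/
theorem stmt12 (Γ : PolyDrawing (completeBipartiteGraph (Fin 2) (Fin 5)))
    (hpl : Γ.IsPlanar) (hmono : Γ.IsYMonotone) (hht : Γ.HasHeight 3) :
    ((Γ.pos (Sum.inl 0)).2 = 1 ∧ (Γ.pos (Sum.inl 1)).2 = 3) ∨
    ((Γ.pos (Sum.inl 0)).2 = 3 ∧ (Γ.pos (Sum.inl 1)).2 = 1) := by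
  have h := hpl.isTwoHub hmono
  have hrow (i : Fin 5) := hht.row (Sum.inr i)
  have hne : (Γ.pos (Sum.inl 0)).2 ≠ (Γ.pos (Sum.inl 1)).2 := by
    intro hab
    obtain ⟨i, -, j, -, hij, heq⟩ := Finset.exists_ne_map_eq_of_card_lt_of_maps_to
      (s := Finset.univ) (t := {(1 : ℝ), 2, 3}) (f := fun i : Fin 5 => (Γ.pos (Sum.inr i)).2)
      (Finset.card_le_three.trans_lt (by simp)) (fun i _ => by simpa using hrow i)
    exact h.leaf_row_ne hab hij heq
  rcases hht.row (Sum.inl 0) with ha | ha | ha <;> rcases hht.row (Sum.inl 1) with hb | hb | hb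
  · exact absurd (ha.trans hb.symm) hne
  · exact (h.false_of_middle (by simp) (.inl ha) hb hrow).elim
  · exact .inl ⟨ha, hb⟩
  · exact (h.swap.false_of_middle (by simp) (.inl hb) ha hrow).elim
  · exact absurd (ha.trans hb.symm) hne
  · exact (h.swap.false_of_middle (by simp) (.inr hb) ha hrow).elim
  · exact .inr ⟨ha, hb⟩
  · exact (h.false_of_middle (by simp) (.inr ha) hb hrow).elim
  · exact absurd (ha.trans hb.symm) hne
end

section
/- Let G be a simple bipartite graph with bipartition V = A ∪ B that admits a planar straight-line drawing. Then G admits a planar straight-line drawing in which every vertex of A has y-coordinate strictly greater than 0 and every vertex of B has y-coordinate strictly less than 0 (a planar straight-line HH-drawing). -/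
open Set

namespace HHDrawing

open Equiv Relation Filter Topology

section Rotations

variable {E : Type}

/-- `f` is, up to sign, a coboundary for the permutation `σ`: its sum over each finite cycle
vanishes. -/
def IsCob (σ : Perm E) (f : E → ℝ) : Prop := ∃ T : E → ℝ, ∀ x, T (σ x) = T x - f x

/-- Every flow is the difference of a potential on the faces of the rotation system. -/
def HasPotentials (σ τ : Perm E) : Prop :=
  ∀ f : E → ℝ, IsCob σ f → IsCob τ f →
    ∃ L : E → ℝ, (∀ x, L (σ x) = L x + f (σ x)) ∧ ∀ x, L (τ x) = L x - f x

/-- `x` and `σ x` bound a face with two sides. -/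
def DigonStep (σ τ : Perm E) (x y : E) : Prop := y = σ x ∧ τ (σ x) = x

/-- Parallel edges are linked by a chain of digons. -/
def Bundled (σ τ : Perm E) : Prop :=
  ∀ x y, σ.SameCycle x y → τ.SameCycle x y →
    ReflTransGen (DigonStep σ τ) x y ∨ ReflTransGen (DigonStep σ τ) y x

theorem IsCob.add {σ : Perm E} {f g : E → ℝ} (hf : IsCob σ f) (hg : IsCob σ g) :
    IsCob σ (fun x => f x + g x) := by
  obtain ⟨S, hS⟩ := hf
  obtain ⟨T, hT⟩ := hg
  exact ⟨fun x => S x + T x, fun x => by simp only [hS, hT]; ring⟩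

theorem IsCob.neg {σ : Perm E} {f : E → ℝ} (hf : IsCob σ f) :
    IsCob σ (fun x => - f x) := by
  obtain ⟨S, hS⟩ := hf
  exact ⟨fun x => - S x, fun x => by simp only [hS]; ring⟩

theorem HasPotentials.symm {σ τ : Perm E} (h : HasPotentials σ τ) : HasPotentials τ σ := by
  intro f hτ hσ
  obtain ⟨L, h1, h2⟩ := h _ hσ.neg hτ.neg
  refine ⟨fun x => L x + f x, fun x => ?_, fun x => ?_⟩
  · simp only [h2]; ring
  · simp only [h1]; ring

theorem digonStep_swap {σ τ : Perm E} {x y : E} : DigonStep τ σ x y ↔ DigonStep σ τ y x := by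
  constructor
  · rintro ⟨rfl, h⟩
    exact ⟨h.symm, by rw [h]⟩
  · rintro ⟨rfl, h⟩
    exact ⟨h.symm, by rw [h]⟩

theorem digonStep_inv {σ τ : Perm E} {x y : E} :
    DigonStep σ⁻¹ τ⁻¹ x y ↔ DigonStep σ τ y x := by
  constructor
  · rintro ⟨rfl, h⟩
    refine ⟨by simp, ?_⟩
    rw [Perm.inv_eq_iff_eq] at h
    simp [← h]
  · rintro ⟨rfl, h⟩
    refine ⟨by simp, ?_⟩
    rw [Perm.inv_eq_iff_eq]
    simp [h]

theorem reflTransGen_swap {α : Type} {r s : α → α → Prop} (h : ∀ x y, r x y → s y x) {x y : α}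
    (hxy : ReflTransGen r x y) : ReflTransGen s y x := by
  induction hxy with
  | refl => exact .refl
  | tail _ hs ih => exact ReflTransGen.head (h _ _ hs) ih

theorem Bundled.symm {σ τ : Perm E} (h : Bundled σ τ) : Bundled τ σ := by
  intro x y h1 h2
  rcases h x y h2 h1 with h | h
  · exact Or.inr (reflTransGen_swap (fun _ _ => digonStep_swap.2) h)
  · exact Or.inl (reflTransGen_swap (fun _ _ => digonStep_swap.2) h)

theorem Bundled.inv {σ τ : Perm E} (h : Bundled σ τ) : Bundled σ⁻¹ τ⁻¹ := by
  intro x y h1 h2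
  rcases h x y (Perm.sameCycle_inv.1 h1) (Perm.sameCycle_inv.1 h2) with h | h
  · exact Or.inr (reflTransGen_swap (fun _ _ => digonStep_inv.2) h)
  · exact Or.inl (reflTransGen_swap (fun _ _ => digonStep_inv.2) h)

theorem sameCycle_of_reflTransGen_digon {σ τ : Perm E} {x y : E}
    (h : ReflTransGen (DigonStep σ τ) x y) : σ.SameCycle x y ∧ τ.SameCycle x y := by
  induction h with
  | refl => exact ⟨.refl _ _, .refl _ _⟩
  | tail _ hs ih =>
    obtain ⟨rfl, h2⟩ := hs
    refine ⟨Perm.sameCycle_apply_right.2 ih.1, ?_⟩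
    rw [← h2] at ih
    exact Perm.sameCycle_apply_right.1 ih.2

/-- Leaving a property along a chain happens at some link. -/
theorem exists_exit_of_reflTransGen {α : Type} {r : α → α → Prop} {P : α → Prop} {u v : α}
    (h : ReflTransGen r u v) (hu : P u) (hv : ¬ P v) :
    ∃ x y, ReflTransGen r u x ∧ r x y ∧ ReflTransGen r y v ∧ P x ∧ ¬ P y := by
  induction h using ReflTransGen.head_induction_on with
  | refl => exact absurd hu hv
  | @head a b hab hbv ih =>
    by_cases hb : P b
    · obtain ⟨x, y, h1, h2, h3⟩ := ih hb
      exact ⟨x, y, h1.head hab, h2, h3⟩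
    · exact ⟨a, b, .refl, hab, hbv, hu, hb⟩

/-- An invariant of a cycle in the finite case only has to be propagated forwards. -/
theorem sameCycle_induction [Finite E] {σ : Perm E} {P : E → Prop} {x y : E}
    (h : σ.SameCycle x y) (hx : P x) (hs : ∀ z, σ.SameCycle x z → P z → P (σ z)) : P y := by
  obtain ⟨n, rfl⟩ := h.exists_nat_pow_eq
  have : ∀ k : ℕ, P ((σ ^ k) x) := by
    intro k
    induction k with
    | zero => simpa
    | succ k ih =>
      rw [pow_succ', Perm.mul_apply]
      exact hs _ (Perm.sameCycle_pow_right.2 (.refl _ _)) ih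
  exact this n

/-- A closed chain along a permutation visits its entire cycle. -/
theorem rel_of_closed_chain [Finite E] {σ : Perm E} {r : E → E → Prop}
    (hr : ∀ x y, r x y → y = σ x) {x : E} (h : ReflTransGen r (σ x) x) (hx : r x (σ x)) {y : E}
    (hy : σ.SameCycle x y) : r y (σ y) := by
  have key : ∀ z, ReflTransGen r z x → r z (σ z) := by
    intro z hzx
    rcases hzx.cases_head with rfl | ⟨c, hc, _⟩
    · exact hx
    · rwa [← hr _ _ hc]
  refine key y (sameCycle_induction (P := fun z => ReflTransGen r z x) hy .refl ?_)
  intro z _ hz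
  rcases hz.cases_head with rfl | ⟨c, hc, hcx⟩
  · exact h
  · rwa [← hr _ _ hc]

variable [DecidableEq E]

theorem isCob_single {σ : Perm E} {a b : E} (h : σ.SameCycle a b) [Finite E] :
    IsCob σ (fun x => (if x = a then 1 else 0) - (if x = b then 1 else 0)) := by
  refine sameCycle_induction (P := fun b => IsCob σ
    (fun x => (if x = a then 1 else 0) - (if x = b then 1 else 0))) h ?_ ?_
  · exact ⟨fun _ => 0, fun x => by simp⟩
  · rintro z - ⟨T, hT⟩
    refine ⟨fun x => T x - if x = σ z then 1 else 0, fun x => ?_⟩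
    simp only [hT, EmbeddingLike.apply_eq_iff_eq]
    ring

/-- Joining the two `τ`-cycles of `e` and `σ e` through the face between these edges. -/
def merge (σ τ : Perm E) (e : E) : Perm E := τ * swap (σ e) (τ⁻¹ e)

theorem merge_apply_next (σ τ : Perm E) (e : E) : merge σ τ e (σ e) = e := by
  simp [merge]

theorem merge_apply_prev (σ τ : Perm E) (e : E) {x : E} (h : τ x = e) :
    merge σ τ e x = τ (σ e) := by
  have : τ⁻¹ e = x := by rw [Perm.inv_eq_iff_eq, h]
  simp only [merge, Perm.mul_apply, this, swap_apply_right]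

theorem merge_apply_of_ne (σ τ : Perm E) (e : E) {x : E} (h1 : x ≠ σ e) (h2 : τ x ≠ e) :
    merge σ τ e x = τ x := by
  have : x ≠ τ⁻¹ e := by
    rintro h
    exact h2 (Perm.eq_inv_iff_eq.1 h)
  simp only [merge, Perm.mul_apply, swap_apply_of_ne_of_ne h1 this]

theorem HasPotentials.merge {σ τ : Perm E} (h : HasPotentials σ τ) {e : E} (he : σ e ≠ e)
    (hne : τ (σ e) ≠ e) : HasPotentials σ (merge σ τ e) := by
  rintro f ⟨S, hS⟩ ⟨T, hT⟩
  obtain ⟨p, hp⟩ := τ.surjective e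
  have hpe : p ≠ σ e := by rintro rfl; exact hne hp
  set s := T e - T p + f p with hs
  have hTe := hT (σ e)
  rw [merge_apply_next] at hTe
  have hTp := hT p
  rw [merge_apply_prev _ _ _ hp] at hTp
  set f1 : E → ℝ := fun x => f x + s * ((if x = σ e then 1 else 0) - (if x = e then 1 else 0))
    with hf1
  have c1 : IsCob σ f1 := by
    refine ⟨fun x => S x + s * if x = σ e then 1 else 0, fun x => ?_⟩
    simp only [hS, hf1, EmbeddingLike.apply_eq_iff_eq]
    ring
  have c2 : IsCob τ f1 := by
    refine ⟨fun x => T x - s * if x = e then 1 else 0, fun x => ?_⟩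
    simp only [hf1]
    by_cases h1 : x = σ e
    · subst h1
      simp only [hne, he, if_true, if_false]
      linarith
    by_cases h2 : τ x = e
    · obtain rfl : x = p := τ.injective (h2.trans hp.symm)
      simp only [hpe, h2, if_true, if_false]
      linarith
    · have h3 := hT x
      rw [merge_apply_of_ne σ τ e h1 h2] at h3
      simp only [h1, h2, if_false]
      linarith
  obtain ⟨L, hL1, hL2⟩ := h f1 c1 c2
  have hLe := hL2 (σ e)
  have hLp := hL2 p
  simp only [hf1, hp, hpe, he, if_true, if_false] at hLe hLp
  have hLn := hL1 e
  simp only [hf1, he, if_true, if_false] at hLn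
  refine ⟨fun x => L x + s * if x = e then 1 else 0, fun x => ?_, fun x => ?_⟩
  · have := hL1 x
    simp only [hf1, EmbeddingLike.apply_eq_iff_eq] at this
    simp only
    linarith
  · by_cases h1 : x = σ e
    · subst h1
      rw [merge_apply_next]
      simp only [he, if_true, if_false]
      linarith
    by_cases h2 : τ x = e
    · obtain rfl : x = p := τ.injective (h2.trans hp.symm)
      rw [merge_apply_prev _ _ _ hp]
      simp only [hne, if_false]
      linarith
    · rw [merge_apply_of_ne σ τ e h1 h2]
      have h3 := hL2 x
      simp only [hf1, h1, if_false] at h3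
      simp only [h2, if_false]
      linarith

end Rotations

section Merge

theorem face_ne_self_of_not_sameCycle {E : Type} {σ τ : Perm E} {e : E} (h : ¬ τ.SameCycle e (σ e)) :
    τ (σ e) ≠ e := by
  intro h2
  apply h
  have := Perm.sameCycle_apply_right.2 (Perm.SameCycle.refl τ (σ e))
  rw [h2] at this
  exact this.symm

variable {E : Type} [DecidableEq E]

/-- Joining the `τ`-cycles of `e` and `σ e` creates no parallel edges other than those linked by
chains of digons. -/
def IsGoodCorner (σ τ : Perm E) (e : E) : Prop :=
  ¬ τ.SameCycle e (σ e) ∧ ∀ e' f', τ.SameCycle e e' → τ.SameCycle (σ e) f' → σ.SameCycle e' f' →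
    σ.SameCycle e e' ∨ (τ (σ (τ (σ e))) = e ∧ σ.SameCycle (τ (σ e)) e')

theorem merge_sameCycle_iff [Finite E] {σ τ : Perm E} {e : E} (h : ¬ τ.SameCycle e (σ e)) {x y : E} :
    (merge σ τ e).SameCycle x y ↔ τ.SameCycle x y ∨
      (τ.SameCycle e x ∧ τ.SameCycle (σ e) y) ∨ (τ.SameCycle (σ e) x ∧ τ.SameCycle e y) := by
  set m := merge σ τ e with hm
  have sr : ∀ {u v : E}, τ.SameCycle u v → τ.SameCycle u (τ v) :=
    fun h => Perm.sameCycle_apply_right.2 h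
  constructor
  · intro hxy
    refine sameCycle_induction (P := fun y => τ.SameCycle x y ∨
      (τ.SameCycle e x ∧ τ.SameCycle (σ e) y) ∨ (τ.SameCycle (σ e) x ∧ τ.SameCycle e y))
      hxy (Or.inl (.refl _ _)) ?_
    intro z _ hz
    by_cases h1 : z = σ e
    · subst h1
      rw [hm, merge_apply_next]
      rcases hz with h2 | ⟨h2, _⟩ | ⟨_, h3⟩
      · exact Or.inr (Or.inr ⟨h2.symm, .refl _ _⟩)
      · exact Or.inl h2.symm
      · exact absurd h3 h
    by_cases h2 : τ z = e
    · rw [hm, merge_apply_prev _ _ _ h2]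
      have h4 : τ.SameCycle z e := by rw [← h2]; exact sr (.refl _ _)
      rcases hz with h3 | ⟨_, h3⟩ | ⟨h3, _⟩
      · exact Or.inr (Or.inl ⟨(h3.trans h4).symm, sr (.refl _ _)⟩)
      · exact absurd (h3.trans h4).symm h
      · exact Or.inl (sr h3.symm)
    · rw [hm, merge_apply_of_ne _ _ _ h1 h2]
      exact hz.imp sr (Or.imp (And.imp_right sr) (And.imp_right sr))
  · have c1 : ∀ y, τ.SameCycle e y → m.SameCycle e y := by
      intro y hy
      refine sameCycle_induction hy (.refl _ _) ?_
      intro z hz ih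
      by_cases h2 : τ z = e
      · rw [h2]
      · have h1 : z ≠ σ e := by rintro rfl; exact h hz
        rw [← merge_apply_of_ne _ _ _ h1 h2]
        exact Perm.sameCycle_apply_right.2 ih
    have c2 : ∀ y, τ.SameCycle (σ e) y → m.SameCycle (τ (σ e)) y := by
      intro y hy
      refine sameCycle_induction (Perm.sameCycle_apply_left.2 hy) (.refl _ _) ?_
      intro z hz ih
      have hz' := Perm.sameCycle_apply_left.1 hz
      by_cases h1 : z = σ e
      · rw [h1]
      · have h2 : τ z ≠ e := by
          intro h2
          exact h (h2 ▸ (sr hz')).symm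
        rw [← merge_apply_of_ne _ _ _ h1 h2]
        exact Perm.sameCycle_apply_right.2 ih
    have c3 : m.SameCycle (τ (σ e)) e := by
      have := c2 (σ e) (.refl _ _)
      rw [← Perm.sameCycle_apply_right, hm, merge_apply_next] at this
      exact this
    have c2' : ∀ y, τ.SameCycle (σ e) y → m.SameCycle e y := fun y hy => c3.symm.trans (c2 y hy)
    rintro (h1 | ⟨h1, h2⟩ | ⟨h1, h2⟩)
    · by_cases hx : τ.SameCycle e x
      · exact (c1 _ hx).symm.trans (c1 _ (hx.trans h1))
      by_cases hx2 : τ.SameCycle (σ e) x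
      · exact (c2' _ hx2).symm.trans (c2' _ (hx2.trans h1))
      refine sameCycle_induction h1 (.refl _ _) ?_
      intro z hz ih
      have h3 : z ≠ σ e := by rintro rfl; exact hx2 hz.symm
      have h4 : τ z ≠ e := by
        intro h2
        exact hx (h2 ▸ (sr hz)).symm
      rw [← merge_apply_of_ne _ _ _ h3 h4]
      exact Perm.sameCycle_apply_right.2 ih
    · exact (c1 _ h1).symm.trans (c2' _ h2)
    · exact (c2' _ h1).symm.trans (c1 _ h2)

theorem merge_face_eq_self {σ τ : Perm E} {e : E} (h : ¬ τ.SameCycle e (σ e)) {x : E}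
    (hx : τ (σ x) = x) : merge σ τ e (σ x) = x := by
  have hxe : x ≠ e := by
    rintro rfl
    exact face_ne_self_of_not_sameCycle h hx
  rw [merge_apply_of_ne, hx]
  · simpa using hxe
  · rwa [hx]

theorem card_support_merge_lt [Fintype E] {σ τ : Perm E} {e : E} (h : ¬ τ.SameCycle e (σ e)) :
    (merge σ τ e * σ).support.card < (τ * σ).support.card := by
  apply Finset.card_lt_card
  rw [Finset.ssubset_iff_of_subset]
  · refine ⟨e, ?_, ?_⟩
    · simpa using face_ne_self_of_not_sameCycle h
    · simp [merge_apply_next]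
  · intro x hx
    rw [Perm.mem_support, Perm.mul_apply] at hx ⊢
    exact fun h2 => hx (merge_face_eq_self h h2)

theorem Bundled.merge [Finite E] {σ τ : Perm E} (hb : Bundled σ τ) {e : E}
    (hg : IsGoodCorner σ τ e) : Bundled σ (merge σ τ e) := by
  obtain ⟨hne, hg⟩ := hg
  have hφ := face_ne_self_of_not_sameCycle hne
  have mono : ∀ {x y}, ReflTransGen (DigonStep σ τ) x y →
      ReflTransGen (DigonStep σ (HHDrawing.merge σ τ e)) x y := by
    intro x y h
    refine ReflTransGen.mono ?_ _ _ h
    rintro a b ⟨rfl, h2⟩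
    exact ⟨rfl, merge_face_eq_self hne h2⟩
  have key : ∀ x y, σ.SameCycle x y → τ.SameCycle e x → τ.SameCycle (σ e) y →
      ReflTransGen (DigonStep σ (HHDrawing.merge σ τ e)) x y ∨
      ReflTransGen (DigonStep σ (HHDrawing.merge σ τ e)) y x := by
    intro x y hxy hx hy
    rcases hg x y hx hy hxy with h1 | ⟨hk, h1⟩
    · left
      have a1 : ReflTransGen (DigonStep σ τ) x e := by
        rcases hb e x h1 hx with h2 | h2
        · rcases h2.cases_head with rfl | ⟨c, hc, _⟩
          · exact .refl
          · exact absurd hc.2 hφ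
        · exact h2
      have a2 : ReflTransGen (DigonStep σ τ) (σ e) y := by
        rcases hb (σ e) y (Perm.sameCycle_apply_left.2 (h1.trans hxy)) hy with h2 | h2
        · exact h2
        · rcases h2.cases_tail with h3 | ⟨c, _, hc⟩
          · rw [h3]
          · obtain rfl : e = c := σ.injective hc.1
            exact absurd hc.2 hφ
      exact ((mono a1).tail ⟨rfl, merge_apply_next _ _ _⟩).trans (mono a2)
    · right
      set k := τ (σ e) with hk'
      have hkk : τ (σ k) ≠ k := by
        intro h2
        exact hφ (h2.symm.trans hk)
      have a1 : ReflTransGen (DigonStep σ τ) y k := by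
        rcases hb k y (h1.trans hxy) (Perm.sameCycle_apply_left.2 hy) with h2 | h2
        · rcases h2.cases_head with h3 | ⟨c, hc, _⟩
          · rw [h3]
          · exact absurd hc.2 hkk
        · exact h2
      have a2 : ReflTransGen (DigonStep σ τ) (σ k) x := by
        have h3 : τ.SameCycle (σ k) x := by
          rw [← Perm.sameCycle_apply_left, hk]; exact hx
        rcases hb (σ k) x (Perm.sameCycle_apply_left.2 h1) h3 with h2 | h2
        · exact h2
        · rcases h2.cases_tail with h3 | ⟨c, _, hc⟩
          · rw [h3]
          · obtain rfl : k = c := σ.injective hc.1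
            exact absurd hc.2 hkk
      exact ((mono a1).tail ⟨rfl, merge_apply_prev _ _ _ hk⟩).trans (mono a2)
  intro x y h1 h2
  rcases (merge_sameCycle_iff hne).1 h2 with h3 | ⟨h3, h4⟩ | ⟨h3, h4⟩
  · exact (hb x y h1 h3).imp mono mono
  · exact key x y h1 h3 h4
  · exact (key y x h1.symm h4 h3).symm

end Merge

section GoodCorner

variable {E : Type} [DecidableEq E]

theorem exists_cycle_potential [Finite E] {σ τ : Perm E} (hP : HasPotentials σ τ) {a b c : E}
    (hab : τ.SameCycle a b) (hbc : σ.SameCycle b c) (hca : τ.SameCycle c (σ a))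
    (hσ : ¬ σ.SameCycle a b) (hτ : ¬ τ.SameCycle a (σ a)) :
    ∃ L : E → ℝ, (∀ x, L (τ (σ x)) = L x) ∧
      (∀ u v, σ.SameCycle u v → ¬ σ.SameCycle u a → ¬ σ.SameCycle u b → L u = L v) ∧
      (∀ u v, τ.SameCycle u v → ¬ τ.SameCycle u a → ¬ τ.SameCycle u (σ a) → L u = L v) ∧
      (∀ x, σ.SameCycle a x → x ≠ a → L x = L a - 1) ∧
      (∀ x, ¬ τ.SameCycle (σ x) a → ¬ τ.SameCycle (σ x) (σ a) → L (σ x) = L x) ∧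
      (c = τ (σ a) → ∀ x, τ.SameCycle c x → x ≠ c → L x = L c - 1) ∧
      (b = σ c → ∀ x, σ.SameCycle c x → x ≠ c → L x = L c - 1) := by
  set f : E → ℝ := fun x => ((if x = a then 1 else 0) - (if x = b then 1 else 0)) +
    ((if x = c then 1 else 0) - (if x = σ a then 1 else 0)) with hf
  have sσ : ∀ u, σ.SameCycle u (σ u) := fun u => Perm.sameCycle_apply_right.2 (.refl _ _)
  have c1 : IsCob τ f := (isCob_single hab).add (isCob_single hca)
  have c2 : IsCob σ f := by
    have := (isCob_single hbc.symm).add (isCob_single (sσ a))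
    convert this using 2
    ring
  obtain ⟨L, h1, h2⟩ := hP f c2 c1
  have fσ : ∀ u, ¬ σ.SameCycle u a → ¬ σ.SameCycle u b → f u = 0 := by
    intro u hua hub
    have e1 : u ≠ a := by rintro rfl; exact hua (.refl _ _)
    have e2 : u ≠ b := by rintro rfl; exact hub (.refl _ _)
    have e3 : u ≠ c := by rintro rfl; exact hub hbc.symm
    have e4 : u ≠ σ a := by rintro rfl; exact hua (sσ a).symm
    simp [hf, e1, e2, e3, e4]
  have fτ : ∀ u, ¬ τ.SameCycle u a → ¬ τ.SameCycle u (σ a) → f u = 0 := by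
    intro u hua hub
    have e1 : u ≠ a := by rintro rfl; exact hua (.refl _ _)
    have e2 : u ≠ b := by rintro rfl; exact hua hab.symm
    have e3 : u ≠ c := by rintro rfl; exact hub hca
    have e4 : u ≠ σ a := by rintro rfl; exact hub (.refl _ _)
    simp [hf, e1, e2, e3, e4]
  refine ⟨L, fun x => ?_, ?_, ?_, ?_, ?_, ?_, ?_⟩
  · rw [h2, h1]; ring
  · intro u v huv ha hb
    refine sameCycle_induction (P := fun v => L u = L v) huv rfl ?_
    intro z hz ih
    rw [h1, fσ, ih, add_zero]
    · exact fun h => ha ((hz.trans (sσ z)).trans h)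
    · exact fun h => hb ((hz.trans (sσ z)).trans h)
  · intro u v huv ha hb
    refine sameCycle_induction (P := fun v => L u = L v) huv rfl ?_
    intro z hz ih
    rw [h2, fτ, ih, sub_zero]
    · exact fun h => ha (hz.trans h)
    · exact fun h => hb (hz.trans h)
  · intro x hx
    refine sameCycle_induction (P := fun x => x ≠ a → L x = L a - 1) hx
      (fun h => absurd rfl h) ?_
    intro z hz ih hza
    have e2 : σ z ≠ b := by rintro h; exact hσ (h ▸ (hz.trans (sσ z)))
    have e3 : σ z ≠ c := by
      rintro h; exact hσ ((h ▸ (hz.trans (sσ z)) : σ.SameCycle a c).trans hbc.symm)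
    rw [h1]
    by_cases hz' : z = a
    · subst hz'
      simp [hf, e2, e3, hza]
      ring
    · rw [ih hz']
      simp [hf, e2, e3, hza, hz']
  · intro x ha hb
    rw [h1, fτ _ ha hb, add_zero]
  · intro hc x hx
    refine sameCycle_induction (P := fun x => x ≠ c → L x = L c - 1) hx
      (fun h => absurd rfl h) ?_
    intro z hz ih hza
    have e1 : z ≠ a := by rintro rfl; exact hτ (hz.symm.trans hca)
    have e2 : z ≠ b := by rintro rfl; exact hτ (hab.trans (hz.symm.trans hca))
    have e4 : z ≠ σ a := by rintro rfl; exact hza hc.symm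
    rw [h2]
    by_cases hz' : z = c
    · subst hz'
      simp [hf, e1, e2, e4]
    · rw [ih hz']
      simp [hf, e1, e2, e4, hz']
  · intro hb x hx
    refine sameCycle_induction (P := fun x => x ≠ c → L x = L c - 1) hx
      (fun h => absurd rfl h) ?_
    intro z hz ih hza
    have hbz : σ.SameCycle b (σ z) := hbc.trans (hz.trans (sσ z))
    have e1 : σ z ≠ a := by
      intro h; rw [h] at hbz; exact hσ hbz.symm
    have e4 : z ≠ a := by
      rintro rfl; exact hσ (hbc.trans hz).symm
    rw [h1]
    by_cases hz' : z = c
    · subst hz'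
      have hbz' : b ≠ a := by rw [hb]; exact e1
      simp [hf, ← hb, hbz', hb ▸ hza]
      rw [hb]
      simp [e4]
      ring
    · rw [ih hz']
      have : σ z ≠ b := by rw [hb]; simpa using hz'
      simp [hf, e1, this, e4, hza]

theorem sameCycle_of_forall_not_good [Finite E] {σ τ : Perm E} (h : ∀ e, ¬ IsGoodCorner τ σ e)
    {x : E} (hx : ∀ y, σ.SameCycle x y → τ.SameCycle x y) {z : E} (hz : τ.SameCycle x z) :
    σ.SameCycle x z := by
  refine sameCycle_induction hz (.refl _ _) ?_
  intro z _ hz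
  by_contra hcon
  refine h z ⟨fun h => hcon (hz.trans h), fun e' f' h1 _ _ => Or.inl ?_⟩
  exact (hx z hz).symm.trans (hx e' (hz.trans h1))

theorem not_sameCycle_of_forall_not_good [Finite E] {σ τ : Perm E} (hB : Bundled σ τ)
    (h : ∀ e, ¬ IsGoodCorner τ σ e) {e : E} (he : τ (σ e) ≠ e) : ¬ τ.SameCycle e (σ e) := by
  intro hs
  have hr : ReflTransGen (DigonStep σ τ) (σ e) e := by
    rcases hB e (σ e) (Perm.sameCycle_apply_right.2 (.refl _ _)) hs with h1 | h1
    · rcases h1.cases_head with h2 | ⟨c, hc, _⟩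
      · rw [← h2]
      · exact absurd hc.2 he
    · exact h1
  have hall : ∀ y, σ.SameCycle e y → ReflTransGen (DigonStep σ τ) y e := by
    intro y hy
    refine sameCycle_induction (P := fun y => ReflTransGen (DigonStep σ τ) y e) hy .refl ?_
    intro z _ hz
    rcases hz.cases_head with h2 | ⟨c, hc, hce⟩
    · rw [h2]; exact hr
    · rwa [← hc.1]
  have h3 : σ.SameCycle e (τ (σ e)) :=
    sameCycle_of_forall_not_good h
      (fun y hy => (sameCycle_of_reflTransGen_digon (hall y hy)).2.symm)
      (Perm.sameCycle_apply_right.2 hs)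
  rcases (hall _ h3).cases_head with h4 | ⟨c, hc, _⟩
  · exact he h4
  · have := hc.2
    exact he (σ.injective (τ.injective this))

/-- A planar rotation system without parallel edges that are not linked by digons either has only
faces with two sides or has a corner at which two vertices can be joined. -/
theorem exists_isGoodCorner [Finite E] {σ τ : Perm E} (hP : HasPotentials σ τ) (hB : Bundled σ τ)
    (hne : τ * σ ≠ 1) : (∃ e, IsGoodCorner σ τ e) ∨ ∃ e, IsGoodCorner τ σ e := by
  by_contra! hcon
  obtain ⟨ng1, ng2⟩ := hcon
  have N2 : ∀ e, τ (σ e) ≠ e → ¬ τ.SameCycle e (σ e) := fun e =>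
    not_sameCycle_of_forall_not_good hB ng2
  have N2' : ∀ e, σ (τ e) ≠ e → ¬ σ.SameCycle e (τ e) := fun e =>
    not_sameCycle_of_forall_not_good hB.symm ng1
  have sσ : ∀ u, σ.SameCycle u (σ u) := fun u => Perm.sameCycle_apply_right.2 (.refl _ _)
  have sτ : ∀ u, τ.SameCycle u (τ u) := fun u => Perm.sameCycle_apply_right.2 (.refl _ _)
  obtain ⟨e, he⟩ : ∃ e, τ (σ e) ≠ e := by
    by_contra! h
    exact hne (Equiv.ext h)
  set k := τ (σ e) with hk
  have hφk : τ (σ k) ≠ k := fun h => he (σ.injective (τ.injective h))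
  have n1 : ¬ τ.SameCycle e (σ e) := N2 e he
  have n2 : ¬ σ.SameCycle (σ e) k := N2' (σ e) (fun h => he (σ.injective h))
  have n2' : ¬ σ.SameCycle e k := fun h => n2 ((sσ e).symm.trans h)
  have n3 : ¬ τ.SameCycle k (σ k) := N2 k hφk
  have n4 : ¬ σ.SameCycle (σ k) (τ (σ k)) := N2' (σ k) (fun h => hφk (σ.injective h))
  have t1 : τ.SameCycle (σ e) k := sτ _
  have g1 := ng1 e
  simp only [IsGoodCorner, n1, not_false_eq_true, true_and, not_forall, not_or, not_and] at g1
  obtain ⟨e', f', hee', hef', hef, n5, n6⟩ := g1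
  have g2 := ng2 (σ e)
  rw [IsGoodCorner] at g2
  simp only [← hk, n2, not_false_eq_true, true_and, not_forall, not_or, not_and] at g2
  obtain ⟨m, m', hm, hm', hmm, n7, n8⟩ := g2
  by_cases hcase : ¬ σ.SameCycle k e' ∧ ¬ τ.SameCycle e m
  · obtain ⟨h1, h2⟩ := hcase
    obtain ⟨L, L1, L2, L3, L4, -⟩ := exists_cycle_potential hP hee' hef hef'.symm n5 n1
    have a1 : L k = L m' := L2 k m' hm' (fun h => n2' h.symm) h1
    have a2 : L m = L m' := L3 m m' hmm (fun h => h2 h.symm) (fun h => n7 h.symm)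
    have a3 : L m = L e - 1 := L4 m ((sσ e).trans hm) (by rintro rfl; exact h2 (.refl _ _))
    have a4 : L k = L e := L1 e
    linarith
  obtain ⟨d, hkd, hed, hφφ⟩ : ∃ d, σ.SameCycle k d ∧ τ.SameCycle e d ∧ τ (σ k) ≠ e := by
    rw [not_and_or, not_not, not_not] at hcase
    rcases hcase with h | h
    · exact ⟨e', h, hee', fun h2 => n6 h2 h⟩
    · refine ⟨m', hm', h.trans hmm, fun h2 => n8 (by rw [h2]) ?_⟩
      rw [← Perm.sameCycle_apply_left, h2]
      exact h
  by_cases hek : τ.SameCycle e (σ k)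
  · obtain ⟨L, L1, L2, L3, L4, L5, L6, L7⟩ := exists_cycle_potential hP hek (sσ k).symm t1.symm
      (fun h => n2' (h.trans (sσ k).symm)) n1
    have hk2 : ¬ σ.SameCycle e (τ (σ k)) := by
      intro h
      rcases hB _ _ h (hek.trans (sτ _)) with h1 | h1
      · rcases h1.cases_head with h2 | ⟨c, hc, _⟩
        · exact hφφ h2.symm
        · exact he hc.2
      · rcases h1.cases_head with h2 | ⟨c, hc, _⟩
        · exact hφφ h2
        · exact hφk (σ.injective (τ.injective hc.2))
    have g3 := ng2 (σ k)
    rw [IsGoodCorner] at g3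
    simp only [n4, not_false_eq_true, true_and, not_forall, not_or, not_and] at g3
    obtain ⟨n, n', hn, hn', hnn, n9, -⟩ := g3
    have a1 : L (τ (σ k)) = L n' :=
      L2 _ _ hn' (fun h => hk2 h.symm) (fun h => n4 h.symm)
    have a2 : L (τ (σ k)) = L k := L1 k
    by_cases hnk : τ.SameCycle n k
    · have hn'k : n' ≠ k := by
        rintro rfl
        exact n4 ((sσ _).symm.trans hn'.symm)
      have a3 := L6 hk n' (hnk.symm.trans hnn) hn'k
      linarith
    · have hnk' : n ≠ k := by rintro rfl; exact hnk (.refl _ _)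
      have a3 := L7 rfl n ((sσ k).trans hn) hnk'
      have a4 := L3 n n' hnn (fun h => n9 (hek.symm.trans h.symm))
        (fun h => hnk (h.trans t1))
      linarith
  · obtain ⟨L, L1, L2, L3, L4, L5, L6, L7⟩ := exists_cycle_potential hP hed hkd.symm t1.symm
      (fun h => n2' (h.trans hkd.symm)) n1
    have g3 := ng1 k
    rw [IsGoodCorner] at g3
    simp only [n3, not_false_eq_true, true_and, not_forall, not_or, not_and] at g3
    obtain ⟨n, n', hn, hn', hnn, n9, -⟩ := g3
    have b1 : L k = L e := L1 e
    have b2 : L (σ k) = L k := L5 k (fun h => hek h.symm) (fun h => n3 (h.trans t1).symm)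
    have b3 : L (σ k) = L n' := L3 _ _ hn' (fun h => hek h.symm) (fun h => n3 (h.trans t1).symm)
    have hnk : n ≠ k := by rintro rfl; exact n9 (.refl _ _)
    have b4 : L n = L k - 1 := L6 hk n hn hnk
    by_cases hne : σ.SameCycle n e
    · have : n' ≠ e := by rintro rfl; exact hek hn'.symm
      have b5 := L4 n' (hne.symm.trans hnn) this
      linarith
    · have b5 := L2 n n' hnn hne (fun h => n9 (hkd.trans h.symm))
      linarith

end GoodCorner

section SplitRotation

variable {E : Type}

/-- Along every cycle of `σ`, the values of `s` decrease at most once. -/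
def IsCyclicMono (σ : Perm E) (s : E → ℝ) : Prop :=
  ∀ x y, σ.SameCycle x y → s (σ x) < s x → s (σ y) < s y → x = y

theorem exists_descent_of_lt (u : ℕ → ℝ) {i j : ℕ} (hij : i ≤ j) (h : u j < u i) :
    ∃ l, i ≤ l ∧ l < j ∧ u (l + 1) < u l := by
  by_contra! hcon
  induction j, hij using Nat.le_induction with
  | base => exact lt_irrefl _ h
  | succ j hij ih =>
    have h1 := hcon j hij (Nat.lt_succ_self j)
    exact ih (lt_of_le_of_lt h1 h) fun l h2 h3 => hcon l h2 (h3.trans (Nat.lt_succ_self j))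

variable [Finite E]

theorem mem_range_of_no_descent {τ : Perm E} {s : E → ℝ} {e p : E} (hp : τ p = e)
    (hs : ∀ x, τ.SameCycle e x → x ≠ p → s x ≤ s (τ x)) {x : E} (hx : τ.SameCycle e x) :
    s e ≤ s x ∧ s x ≤ s p := by
  have hep : τ.SameCycle e p := by rw [← hp]; exact Perm.sameCycle_apply_left.2 (.refl _ _)
  constructor
  · refine sameCycle_induction (P := fun x => s e ≤ s x) hx le_rfl ?_
    intro z hz ih
    by_cases h : z = p
    · rw [h, hp]
    · exact ih.trans (hs z hz h)
  · have hx' : τ⁻¹.SameCycle p x := Perm.sameCycle_inv.2 (hep.symm.trans hx)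
    refine sameCycle_induction (P := fun x => s x ≤ s p) hx' le_rfl ?_
    intro z hz ih
    obtain ⟨w, rfl⟩ := τ.surjective z
    have hw : τ⁻¹ (τ w) = w := τ.symm_apply_apply w
    rw [hw]
    by_cases h : w = p
    · rw [h]
    · have := Perm.sameCycle_apply_right.1 (Perm.sameCycle_inv.1 hz)
      exact (hs w (hep.trans this) h).trans ih

variable [DecidableEq E]

theorem le_or_le_of_no_descent {σ τ : Perm E} {s : E → ℝ} {e p : E}
    (hne : ¬ τ.SameCycle e (σ e)) (hp : τ p = e)
    (hrot : IsCyclicMono (merge σ τ e) s) (hse : s (σ e) = s e)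
    {y : E} (hy : τ.SameCycle (σ e) y) : s y ≤ s e ∨ s p ≤ s y := by
  classical
  have hep : τ.SameCycle e p := by rw [← hp]; exact Perm.sameCycle_apply_left.2 (.refl _ _)
  set m := merge σ τ e with hm
  have hk : ∃ k : ℕ, (τ ^ k) (τ (σ e)) = σ e :=
    (Perm.sameCycle_apply_left.2 (.refl τ (σ e))).exists_nat_pow_eq
  set k := Nat.find hk with hkdef
  have hk1 : (τ ^ k) (τ (σ e)) = σ e := Nat.find_spec hk
  set w : ℕ → E := fun i => (τ ^ i) (τ (σ e)) with hw
  have wsucc : ∀ i, w (i + 1) = τ (w i) := fun i => by simp only [hw, pow_succ', Perm.mul_apply]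
  have wsame : ∀ i, τ.SameCycle (σ e) (w i) := fun i =>
    Perm.sameCycle_pow_right.2 (Perm.sameCycle_apply_right.2 (.refl _ _))
  have wne : ∀ i < k, w i ≠ σ e := fun i hi => Nat.find_min hk hi
  have hm_eq : ∀ i < k, m (w i) = w (i + 1) := by
    intro i hi
    rw [wsucc, hm, merge_apply_of_ne _ _ _ (wne i hi)]
    intro h
    apply hne
    have := Perm.sameCycle_apply_right.2 (wsame i)
    rw [h] at this
    exact this.symm
  have winj : ∀ i j, i < j → j < k → w i ≠ w j := by
    intro i j hij hj h
    have h1 : w (k - j + i) = σ e := by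
      have h2 : w (k - j + i) = (τ ^ (k - j)) (w i) := by
        simp only [hw, pow_add, Perm.mul_apply]
      rw [h2, h]
      have h3 : (τ ^ (k - j)) (w j) = w (k - j + j) := by
        simp only [hw, pow_add, Perm.mul_apply]
      rw [h3, Nat.sub_add_cancel hj.le]
      exact hk1
    exact wne _ (by omega) h1
  have wm : ∀ i j, m.SameCycle (w i) (w j) := fun i j =>
    (merge_sameCycle_iff hne).2 (Or.inl ((wsame i).symm.trans (wsame j)))
  obtain ⟨i, hik, rfl⟩ : ∃ i ≤ k, w i = y := by
    have h0 : ∃ i ≤ k, w i = σ e := ⟨k, le_rfl, hk1⟩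
    refine sameCycle_induction (P := fun y => ∃ i ≤ k, w i = y) hy h0 ?_
    rintro z - ⟨i, hi, rfl⟩
    rcases hi.lt_or_eq with h | rfl
    · exact ⟨i + 1, h, wsucc i⟩
    · refine ⟨0, Nat.zero_le _, ?_⟩
      simp only [hw, hk1, pow_zero, Perm.one_apply]
  by_contra! hcon
  obtain ⟨h1, h2⟩ := hcon
  have hwk : s (w k) = s e := by rw [← hse]; exact congrArg s hk1
  obtain ⟨j2, j2a, j2b, j2c⟩ := exists_descent_of_lt (fun i => s (w i)) hik (by simpa [hwk] using h1)
  have hpm : m p = w 0 := by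
    rw [hm, merge_apply_prev _ _ _ hp]; simp [hw]
  by_cases h3 : s (w 0) < s p
  · have : p = w j2 := by
      refine hrot p (w j2) ?_ (by rwa [hpm]) (by rw [hm_eq _ j2b]; exact j2c)
      exact (merge_sameCycle_iff hne).2 (Or.inr (Or.inl ⟨hep, wsame _⟩))
    exact hne ((this ▸ hep).trans (wsame j2).symm)
  · obtain ⟨j1, j1a, j1b, j1c⟩ := exists_descent_of_lt (fun i => s (w i)) (Nat.zero_le i)
      (lt_of_lt_of_le h2 (not_lt.1 h3))
    have hj1k : j1 < k := j1b.trans_le hik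
    have := hrot (w j1) (w j2) (wm _ _) (by rw [hm_eq _ hj1k]; exact j1c)
      (by rw [hm_eq _ j2b]; exact j2c)
    exact winj j1 j2 (by omega) j2b this

theorem isCyclicMono_split_bottom {σ τ : Perm E} {s s' : E → ℝ} {e p : E}
    (hne : ¬ τ.SameCycle e (σ e)) (hp : τ p = e)
    (hrot : IsCyclicMono (merge σ τ e) s) (hse : s (σ e) = s e)
    (hs : ∀ x, τ.SameCycle e x → x ≠ p → s x ≤ s (τ x))
    (hK : ∀ x y, (merge σ τ e).SameCycle x y → s x = s y → σ.SameCycle x y)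
    (h1 : ∀ x, ¬ τ.SameCycle e x → s' x = s x)
    (h2 : ∀ x y, s x < s y → s' x < s' y)
    (h3 : ∀ x y, τ.SameCycle e x → τ.SameCycle e y → σ.SameCycle x y → s x = s y → s' x = s' y) :
    IsCyclicMono τ s' := by
  have hep : τ.SameCycle e p := by rw [← hp]; exact Perm.sameCycle_apply_left.2 (.refl _ _)
  set m := merge σ τ e with hm
  have m_of_same : ∀ {x y}, τ.SameCycle x y → m.SameCycle x y := fun h =>
    (merge_sameCycle_iff hne).2 (Or.inl h)
  have hM : ∀ x, τ.SameCycle e x → s' (τ x) < s' x → x = p := by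
    intro x hx hlt
    by_contra hxp
    have hx' := Perm.sameCycle_apply_right.2 hx
    rcases (hs x hx hxp).lt_or_eq with h | h
    · exact lt_asymm (h2 _ _ h) hlt
    · have := hK x (τ x) (m_of_same (hx.symm.trans hx')) h
      exact hlt.ne (h3 _ _ hx hx' this h).symm
  have hN : ∀ y, τ.SameCycle (σ e) y → y ≠ σ e → s (τ y) < s y → s (τ (σ e)) < s (σ e) → False := by
    intro y hy hye hd hd'
    have hpy : s p ≤ s (τ (σ e)) := by
      by_contra! h
      have hpm : m p = τ (σ e) := merge_apply_prev _ _ _ hp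
      have hym : m y = τ y := by
        refine merge_apply_of_ne _ _ _ hye fun h => hne ?_
        have := Perm.sameCycle_apply_right.2 hy
        rw [h] at this
        exact this.symm
      have := hrot p y ((merge_sameCycle_iff hne).2 (Or.inr (Or.inl ⟨hep, hy⟩)))
        (by rwa [hpm]) (by rwa [hym])
      exact hne ((this ▸ hep).trans hy.symm)
    have := (mem_range_of_no_descent hp hs hep).1
    linarith
  intro x y hxy hx hy
  by_cases hxe : τ.SameCycle e x
  · rw [hM x hxe hx, hM y (hxe.trans hxy) hy]
  have hye : ¬ τ.SameCycle e y := fun h => hxe (h.trans hxy.symm)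
  rw [h1 x hxe, h1 _ (fun h => hxe (Perm.sameCycle_apply_right.1 h))] at hx
  rw [h1 y hye, h1 _ (fun h => hye (Perm.sameCycle_apply_right.1 h))] at hy
  by_cases hx1 : x = σ e
  · subst hx1
    by_contra h
    exact hN y hxy (Ne.symm h) hy hx
  by_cases hy1 : y = σ e
  · subst hy1
    exact (hN x hxy.symm hx1 hx hy).elim
  have hmx : m x = τ x := merge_apply_of_ne _ _ _ hx1 fun h => hxe (by
    rw [← h]; exact Perm.sameCycle_apply_left.2 (.refl _ _))
  have hmy : m y = τ y := merge_apply_of_ne _ _ _ hy1 fun h => hye (by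
    rw [← h]; exact Perm.sameCycle_apply_left.2 (.refl _ _))
  exact hrot x y (m_of_same hxy) (by rwa [hmx]) (by rwa [hmy])

theorem reflTransGen_closed {σ : Perm E} {r : E → E → Prop} (hr : ∀ x y, r x y → y = σ x) {x y : E}
    (h : ReflTransGen r (σ x) x) (hy : σ.SameCycle x y) :
    ReflTransGen r (σ x) y ∧ ReflTransGen r y x := by
  have hr' : ∀ y, ReflTransGen r y x → y = x ∨ (r y (σ y) ∧ ReflTransGen r (σ y) x) := by
    intro y hy
    rcases hy.cases_head with h | ⟨c, hc, hcx⟩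
    · exact Or.inl h
    · rw [← hr _ _ hc]
      exact Or.inr ⟨hc, hcx⟩
  refine sameCycle_induction (P := fun y => ReflTransGen r (σ x) y ∧ ReflTransGen r y x)
    (Perm.sameCycle_apply_left.2 hy) ⟨.refl, h⟩ ?_
  rintro z - ⟨ha, hb⟩
  rcases hr' z hb with rfl | ⟨hz, hz'⟩
  · exact ⟨.refl, h⟩
  · exact ⟨ha.tail hz, hz'⟩

theorem isCyclicMono_split_top {σ τ : Perm E} {s s' : E → ℝ} {e p : E}
    (hb : Bundled σ τ) (hb' : Bundled σ (merge σ τ e))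
    (hne : ¬ τ.SameCycle e (σ e)) (hp : τ p = e)
    (hrot : IsCyclicMono σ s)
    (hs : ∀ x, τ.SameCycle e x → x ≠ p → s x ≤ s (τ x))
    (hK0 : ∀ x y, σ.SameCycle x y → (merge σ τ e).SameCycle x y → s x = s y)
    (hK1 : ∀ x y, σ.SameCycle x y → s x = s y → (merge σ τ e).SameCycle x y)
    (hK2 : ∀ x y, (merge σ τ e).SameCycle x y → s x = s y → σ.SameCycle x y)
    (h1 : ∀ x, ¬ τ.SameCycle e x → s' x = s x)
    (h2 : ∀ x y, s x < s y → s' x < s' y)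
    (h3 : ∀ x y, τ.SameCycle e x → τ.SameCycle e y → σ.SameCycle x y → s x = s y → s' x = s' y)
    (h4 : ∀ x, τ.SameCycle e x → s e < s x → s x < s' x)
    (h5 : ∀ x, τ.SameCycle e x → s x = s e → s' x < s x) :
    IsCyclicMono σ s' := by
  have hep : τ.SameCycle e p := by rw [← hp]; exact Perm.sameCycle_apply_left.2 (.refl _ _)
  have hφ : τ (σ e) ≠ e := face_ne_self_of_not_sameCycle hne
  have sσ : ∀ u, σ.SameCycle u (σ u) := fun u => Perm.sameCycle_apply_right.2 (.refl _ _)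
  set m := merge σ τ e with hm
  have me : DigonStep σ m e (σ e) := ⟨rfl, merge_apply_next _ _ _⟩
  have hse : s (σ e) = s e :=
    (hK0 e (σ e) (sσ e)
      ((merge_sameCycle_iff hne).2 (Or.inr (Or.inl ⟨.refl _ _, .refl _ _⟩)))).symm
  -- the joined cycle changes sides only after `p` and `σ e`
  have exitM : ∀ x, τ.SameCycle e x → ¬ τ.SameCycle e (σ x) → m (σ x) = x → x = e := by
    intro x hx hx' hd
    by_cases h : σ x = σ e
    · exact σ.injective h
    · by_cases h' : τ (σ x) = e
      · exact absurd (Perm.sameCycle_apply_right.1 (h' ▸ .refl _ _)) hx'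
      · rw [hm, merge_apply_of_ne _ _ _ h h'] at hd
        exact absurd (Perm.sameCycle_apply_right.1 (hd.symm ▸ hx)) hx'
  have enterM : ∀ x, ¬ τ.SameCycle e x → τ.SameCycle e (σ x) → m (σ x) = x →
      σ x = p ∧ x = τ (σ e) := by
    intro x hx hx' hd
    have h : σ x ≠ σ e := fun h => hne (h ▸ hx')
    by_cases h' : τ (σ x) = e
    · refine ⟨τ.injective (h'.trans hp.symm), ?_⟩
      rw [hm, merge_apply_prev _ _ _ h'] at hd
      exact hd.symm
    · rw [hm, merge_apply_of_ne _ _ _ h h'] at hd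
      exact absurd (hd ▸ Perm.sameCycle_apply_right.2 hx') hx
  -- a new descent between edges of equal key
  let A : E → Prop := fun x => τ.SameCycle e x ∧ ¬ τ.SameCycle e (σ x) ∧ s e < s x
  let B : E → Prop := fun x => ¬ τ.SameCycle e x ∧ τ.SameCycle e (σ x) ∧ s x = s e
  have tie : ∀ x, s' (σ x) < s' x → ¬ s (σ x) < s x → s (σ x) = s x ∧ (A x ∨ B x) := by
    intro x hx hnx
    have heq : s (σ x) = s x := by
      by_contra hne'
      exact lt_asymm hx (h2 _ _ (lt_of_le_of_ne (not_lt.1 hnx) (Ne.symm hne')))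
    refine ⟨heq, ?_⟩
    by_cases hxM : τ.SameCycle e x <;> by_cases hxM' : τ.SameCycle e (σ x)
    · exact absurd (h3 _ _ hxM' hxM (sσ x).symm heq) hx.ne
    · left
      refine ⟨hxM, hxM', lt_of_le_of_ne (mem_range_of_no_descent hp hs hxM).1 fun h => ?_⟩
      have := h5 x hxM h.symm
      rw [h1 _ hxM'] at hx
      linarith
    · right
      refine ⟨hxM, hxM', ?_⟩
      by_contra h
      have h6 : s e ≤ s (σ x) := (mem_range_of_no_descent hp hs hxM').1
      have h7 : s e < s (σ x) := lt_of_le_of_ne h6 fun h' => h (by rw [h', heq])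
      have := h4 _ hxM' h7
      rw [h1 _ hxM] at hx
      linarith
    · rw [h1 _ hxM, h1 _ hxM'] at hx
      exact absurd heq hx.ne
  have closed : ∀ x, s (σ x) = s x → m (σ x) ≠ x →
      ReflTransGen (DigonStep σ m) (σ x) x := by
    intro x hx hd
    rcases hb' x (σ x) (sσ x) (hK1 _ _ (sσ x) hx.symm) with h | h
    · rcases h.cases_head with h | ⟨c, hc, _⟩
      · rw [← h]
      · exact absurd hc.2 hd
    · exact h
  have constant : ∀ x, s (σ x) = s x → (A x ∨ B x) → ∀ z, σ.SameCycle x z → s z = s x := by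
    intro x hx hAB z hz
    by_cases hd : m (σ x) = x
    · rcases hAB with ⟨ha, hb0, hc⟩ | ⟨ha, hb0, hc⟩
      · rw [exitM x ha hb0 hd] at hc
        exact absurd hc (lt_irrefl _)
      · obtain ⟨q1, q2⟩ := enterM x ha hb0 hd
        have hmN : τ.SameCycle (σ e) x := by
          rw [q2]; exact Perm.sameCycle_apply_right.2 (.refl _ _)
        have c1 : ReflTransGen (DigonStep σ τ) (σ e) x := by
          have q3 : σ.SameCycle (σ e) x :=
            hK2 _ _ ((merge_sameCycle_iff hne).2 (Or.inl hmN)) (hse.trans hc.symm)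
          rcases hb (σ e) x q3 hmN with h | h
          · exact h
          · rcases h.cases_head with h | ⟨c, hc, _⟩
            · rw [← h]
            · have := hc.2
              rw [q1, hp] at this
              exact absurd (this ▸ .refl _ _) ha
        have hsp : s p = s e := by rw [← q1, hx, hc]
        have c2 : ReflTransGen (DigonStep σ τ) p e := by
          have q3 : σ.SameCycle p e :=
            hK2 _ _ ((merge_sameCycle_iff hne).2 (Or.inl hep.symm)) hsp
          rcases hb p e q3 hep.symm with h | h
          · exact h
          · rcases h.cases_head with h | ⟨c, hc, _⟩
            · rw [h]
            · exact absurd hc.2 hφ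
        let r : E → E → Prop := fun u v => v = σ u ∧ s v = s u
        have conv : ∀ {u v}, ReflTransGen (DigonStep σ τ) u v → ReflTransGen r u v := by
          intro u v h
          refine ReflTransGen.mono ?_ _ _ h
          rintro a b hab
          refine ⟨hab.1, ?_⟩
          obtain ⟨g1, g2⟩ := sameCycle_of_reflTransGen_digon (ReflTransGen.single hab)
          exact (hK0 _ _ g1 ((merge_sameCycle_iff hne).2 (Or.inl g2))).symm
        have hr : ReflTransGen r (σ e) e := by
          refine ((conv c1).tail ⟨rfl, hx⟩).trans ?_
          rw [q1]
          exact conv c2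
        have rconst : ∀ {u v}, ReflTransGen r u v → s v = s u := by
          intro u v h
          induction h with
          | refl => rfl
          | tail _ h ih => rw [h.2, ih]
        have hez : σ.SameCycle e z := by
          have := (sameCycle_of_reflTransGen_digon c1).1
          exact (sσ e).trans (this.trans hz)
        have := rconst (reflTransGen_closed (fun _ _ h => h.1) hr hez).2
        rw [← this, hc]
    · have := (reflTransGen_closed (fun _ _ h => h.1) (closed x hx hd) hz).2
      obtain ⟨g1, g2⟩ := sameCycle_of_reflTransGen_digon this
      exact hK0 _ _ g1 g2
  have unique : ∀ x y, σ.SameCycle x y → s (σ x) = s x → m (σ x) ≠ x → m (σ y) ≠ y → x = y := by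
    intro x y hxy hx hdx hdy
    have := (reflTransGen_closed (fun _ _ h => h.1) (closed x hx hdx) hxy).2
    rcases this.cases_head with h | ⟨c, hc, _⟩
    · exact h.symm
    · exact absurd hc.2 hdy
  have mixed : ∀ x y, σ.SameCycle x y → s (σ y) = s y → B x → B y → m (σ x) = x →
      m (σ y) ≠ y → False := by
    intro x y hxy hy hBx hBy hdx hdy
    have hcl := reflTransGen_closed (fun _ _ h => h.1) (closed y hy hdy) hxy.symm
    have xstep : DigonStep σ m x (σ x) := ⟨rfl, hdx⟩
    obtain ⟨u, v, g1, g2, g3, g4, g5⟩ := exists_exit_of_reflTransGen hcl.1 hBy.2.1 hBx.1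
    obtain rfl : v = σ u := g2.1
    obtain rfl := exitM u g4 g5 g2.2
    have hcl2 : ReflTransGen (DigonStep σ m) (σ x) y := by
      rcases hcl.2.cases_head with h | ⟨c, hc, hcy⟩
      · subst h; exact absurd hdx hdy
      · rwa [← hc.1]
    obtain ⟨u', v', k1, k2, k3, k4, k5⟩ := exists_exit_of_reflTransGen hcl2 hBx.2.1 hBy.1
    obtain rfl : v' = σ u' := k2.1
    obtain rfl := exitM u' k4 k5 k2.2
    have hux : σ.SameCycle (σ u') x := (sameCycle_of_reflTransGen_digon g3).1
    have hcc : ReflTransGen (DigonStep σ m) (σ u') u' := (g3.tail xstep).trans k1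
    exact hdy (rel_of_closed_chain (fun _ _ h => h.1) hcc g2 ((sσ u').trans (hux.trans hxy))).2
  intro x y hxy hx hy
  by_cases hx1 : s (σ x) < s x
  · by_cases hy1 : s (σ y) < s y
    · exact hrot x y hxy hx1 hy1
    · obtain ⟨t1, t2⟩ := tie y hy hy1
      have := constant y t1 t2
      rw [this x hxy.symm, this (σ x) (hxy.symm.trans (sσ x))] at hx1
      exact absurd hx1 (lt_irrefl _)
  obtain ⟨t1, t2⟩ := tie x hx hx1
  have hc := constant x t1 t2
  have hy1 : ¬ s (σ y) < s y := by
    rw [hc y hxy, hc (σ y) (hxy.trans (sσ y))]; exact lt_irrefl _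
  obtain ⟨t3, t4⟩ := tie y hy hy1
  have hsxy := hc y hxy
  have Adig : ∀ z, A z → m (σ z) ≠ z := by
    intro z hz hd
    have hh := hz.2.2
    rw [exitM z hz.1 hz.2.1 hd] at hh
    exact lt_irrefl _ hh
  rcases t2 with hA | hB
  · rcases t4 with hA' | hB'
    · exact unique x y hxy t1 (Adig x hA) (Adig y hA')
    · have := hA.2.2
      have := hB'.2.2
      linarith
  · rcases t4 with hA' | hB'
    · have := hA'.2.2
      have := hB.2.2
      linarith
    · by_cases hdx : m (σ x) = x <;> by_cases hdy : m (σ y) = y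
      · rw [(enterM x hB.1 hB.2.1 hdx).2, (enterM y hB'.1 hB'.2.1 hdy).2]
      · exact (mixed x y hxy t3 hB hB' hdx hdy).elim
      · exact (mixed y x hxy.symm t1 hB' hB hdy hdx).elim
      · exact unique x y hxy t1 hdx hdy

end SplitRotation

section Segments

/-- The horizontal displacement per unit of descent of the segment from `a` down to `b`. -/
noncomputable def tilt (a b : ℝ × ℝ) : ℝ := (b.1 - a.1) / (a.2 - b.2)

theorem tilt_mul {a b : ℝ × ℝ} (h : b.2 < a.2) : tilt a b * (a.2 - b.2) = b.1 - a.1 :=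
  div_mul_cancel₀ _ (sub_pos.2 h).ne'

theorem mem_segment_iff_tilt {a b q : ℝ × ℝ} (h : b.2 < a.2) :
    q ∈ segment ℝ a b ↔
      q.1 + tilt a b * q.2 = b.1 + tilt a b * b.2 ∧ b.2 ≤ q.2 ∧ q.2 ≤ a.2 := by
  have ht := tilt_mul h
  have hpos := sub_pos.2 h
  constructor
  · rintro ⟨u, v, hu, hv, huv, rfl⟩
    obtain rfl : u = 1 - v := by linarith
    simp only [Prod.fst_add, Prod.smul_fst, Prod.snd_add, Prod.smul_snd, smul_eq_mul]
    refine ⟨?_, by nlinarith, by nlinarith⟩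
    linear_combination (v - 1) * (-ht)
  · rintro ⟨h1, h2, h3⟩
    refine ⟨(q.2 - b.2) / (a.2 - b.2), (a.2 - q.2) / (a.2 - b.2), ?_, ?_, ?_, ?_⟩
    · exact div_nonneg (by linarith) hpos.le
    · exact div_nonneg (by linarith) hpos.le
    · field_simp; ring
    · ext
      · simp only [Prod.fst_add, Prod.smul_fst, smul_eq_mul]
        field_simp
        linear_combination (-(a.2 - b.2)) * h1 + (q.2 - b.2) * ht
      · simp only [Prod.snd_add, Prod.smul_snd, smul_eq_mul]
        field_simp
        ring

theorem eq_top_of_mem_segments {a b b' q : ℝ × ℝ} (h : b.2 < a.2) (h' : b'.2 < a.2)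
    (hne : tilt a b ≠ tilt a b') (hq : q ∈ segment ℝ a b) (hq' : q ∈ segment ℝ a b') : q = a := by
  have h1 := ((mem_segment_iff_tilt h).1 hq).1
  have h2 := ((mem_segment_iff_tilt h').1 hq').1
  have t1 := tilt_mul h
  have t2 := tilt_mul h'
  have h3 : (tilt a b - tilt a b') * (q.2 - a.2) = 0 := by linear_combination h1 - h2 - t1 + t2
  have h4 : q.2 = a.2 := by
    rcases mul_eq_zero.1 h3 with h | h
    · exact absurd (sub_eq_zero.1 h) hne
    · exact sub_eq_zero.1 h
  ext
  · rw [h4] at h1; linarith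
  · exact h4

theorem eq_bottom_of_mem_segments {a a' b q : ℝ × ℝ} (h : b.2 < a.2) (h' : b.2 < a'.2)
    (hne : tilt a b ≠ tilt a' b) (hq : q ∈ segment ℝ a b) (hq' : q ∈ segment ℝ a' b) : q = b := by
  have h1 := ((mem_segment_iff_tilt h).1 hq).1
  have h2 := ((mem_segment_iff_tilt h').1 hq').1
  have h3 : (tilt a b - tilt a' b) * (q.2 - b.2) = 0 := by linear_combination h1 - h2
  have h4 : q.2 = b.2 := by
    rcases mul_eq_zero.1 h3 with h | h
    · exact absurd (sub_eq_zero.1 h) hne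
    · exact sub_eq_zero.1 h
  ext
  · rw [h4] at h1; linarith
  · exact h4

theorem isCompact_segment (a b : ℝ × ℝ) : IsCompact (segment ℝ a b) := by
  rw [segment_eq_image]
  exact isCompact_Icc.image (by fun_prop)

theorem eventually_disjoint_segment {a : ℝ × ℝ} {b : ℝ → ℝ × ℝ} (hb : Continuous b)
    {Z : Set (ℝ × ℝ)} (hZ : IsClosed Z) (h : Disjoint (segment ℝ a (b 0)) Z) :
    ∀ᶠ ε in 𝓝 0, Disjoint (segment ℝ a (b ε)) Z := by
  have hc : Continuous fun z : ℝ × ℝ => (1 - z.2) • a + z.2 • b z.1 := by fun_prop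
  have : ∀ᶠ ε in 𝓝 (0 : ℝ), ∀ t ∈ Icc (0 : ℝ) 1, (1 - t) • a + t • b ε ∈ Zᶜ := by
    refine isCompact_Icc.eventually_forall_of_forall_eventually ?_
    intro t ht
    refine hc.continuousAt.eventually_mem (hZ.isOpen_compl.mem_nhds ?_)
    intro hz
    refine Set.disjoint_left.1 h ?_ hz
    rw [segment_eq_image]
    exact ⟨t, ht, rfl⟩
  filter_upwards [this] with ε hε
  rw [Set.disjoint_left, segment_eq_image]
  rintro _ ⟨t, ht, rfl⟩
  exact hε t ht

end Segments

section Drawing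

variable {E : Type}

/-- `pA` and `pB` give the ends of each edge in a planar straight-line drawing with the cycles of
`σ` above and the cycles of `τ` below the horizontal axis, in the given cyclic orders; parallel
edges are drawn on top of each other. -/
structure IsHHDrawing (σ τ : Perm E) (pA pB : E → ℝ × ℝ) : Prop where
  top_apply : ∀ x, pA (σ x) = pA x
  bottom_apply : ∀ x, pB (τ x) = pB x
  top_pos : ∀ x, 0 < (pA x).2
  bottom_neg : ∀ x, (pB x).2 < 0
  planar : ∀ x y, ∀ q ∈ segment ℝ (pA x) (pB x), q ∈ segment ℝ (pA y) (pB y) →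
    (σ.SameCycle x y ∧ q = pA x) ∨ (τ.SameCycle x y ∧ q = pB x) ∨
      (σ.SameCycle x y ∧ τ.SameCycle x y)
  top_mono : IsCyclicMono σ fun x => tilt (pA x) (pB x)
  bottom_mono : IsCyclicMono τ fun x => tilt (pA x) (pB x)

namespace IsHHDrawing

variable {σ τ : Perm E} {pA pB : E → ℝ × ℝ}

theorem lt (h : IsHHDrawing σ τ pA pB) (x y : E) : (pB x).2 < (pA y).2 :=
  (h.bottom_neg x).trans (h.top_pos y)

theorem top_ne_bottom (h : IsHHDrawing σ τ pA pB) (x y : E) : pA x ≠ pB y := fun hxy =>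
  (h.lt y x).ne (by rw [hxy])

theorem top_eq [Finite E] (h : IsHHDrawing σ τ pA pB) {x y : E} (hxy : σ.SameCycle x y) :
    pA y = pA x :=
  sameCycle_induction (P := fun y => pA y = pA x) hxy rfl
    fun z _ hz => (h.top_apply z).trans hz

theorem bottom_eq [Finite E] (h : IsHHDrawing σ τ pA pB) {x y : E} (hxy : τ.SameCycle x y) :
    pB y = pB x :=
  sameCycle_induction (P := fun y => pB y = pB x) hxy rfl
    fun z _ hz => (h.bottom_apply z).trans hz

theorem bottom_sameCycle_of_tilt_eq [Finite E] (h : IsHHDrawing σ τ pA pB) {x y : E}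
    (hxy : σ.SameCycle x y) (ht : tilt (pA x) (pB x) = tilt (pA y) (pB y)) : τ.SameCycle x y := by
  have key : ∀ x y, σ.SameCycle x y → tilt (pA x) (pB x) = tilt (pA y) (pB y) →
      (pB y).2 ≤ (pB x).2 → τ.SameCycle x y := by
    intro x y hxy ht hle
    have hmem : pB x ∈ segment ℝ (pA y) (pB y) := by
      rw [mem_segment_iff_tilt (h.lt y y)]
      refine ⟨?_, hle, (h.lt x y).le⟩
      have t1 := tilt_mul (h.lt x x)
      have t2 := tilt_mul (h.lt y y)
      rw [h.top_eq hxy] at t2 ht ⊢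
      rw [← ht] at t2 ⊢
      linear_combination t2 - t1
    rcases h.planar x y _ (right_mem_segment _ _ _) hmem with h1 | h1 | h1
    · exact absurd h1.2.symm (h.top_ne_bottom _ _)
    · exact h1.1
    · exact h1.2
  rcases le_total (pB y).2 (pB x).2 with hle | hle
  · exact key x y hxy ht hle
  · exact (key y x hxy.symm ht.symm hle).symm

theorem top_sameCycle_of_tilt_eq [Finite E] (h : IsHHDrawing σ τ pA pB) {x y : E}
    (hxy : τ.SameCycle x y) (ht : tilt (pA x) (pB x) = tilt (pA y) (pB y)) : σ.SameCycle x y := by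
  have key : ∀ x y, τ.SameCycle x y → tilt (pA x) (pB x) = tilt (pA y) (pB y) →
      (pA x).2 ≤ (pA y).2 → σ.SameCycle x y := by
    intro x y hxy ht hle
    have hmem : pA x ∈ segment ℝ (pA y) (pB y) := by
      rw [mem_segment_iff_tilt (h.lt y y)]
      refine ⟨?_, (h.lt y x).le, hle⟩
      have t1 := tilt_mul (h.lt x x)
      rw [h.bottom_eq hxy] at ht ⊢
      rw [← ht]
      linear_combination t1
    rcases h.planar x y _ (left_mem_segment _ _ _) hmem with h1 | h1 | h1
    · exact h1.1
    · exact absurd h1.2 (h.top_ne_bottom _ _)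
    · exact h1.1
  rcases le_total (pA x).2 (pA y).2 with hle | hle
  · exact key x y hxy ht hle
  · exact (key y x hxy.symm ht.symm hle).symm

end IsHHDrawing

theorem IsCyclicMono.inv {σ : Perm E} {s t : E → ℝ} (h : IsCyclicMono σ s) (ht : ∀ x, t x = - s x) :
    IsCyclicMono σ⁻¹ t := by
  intro x y hxy hx hy
  obtain ⟨u, rfl⟩ := σ.surjective x
  obtain ⟨v, rfl⟩ := σ.surjective y
  have hu : σ⁻¹ (σ u) = u := σ.symm_apply_apply u
  have hv : σ⁻¹ (σ v) = v := σ.symm_apply_apply v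
  rw [hu, ht, ht, neg_lt_neg_iff] at hx
  rw [hv, ht, ht, neg_lt_neg_iff] at hy
  rw [h u v _ hx hy]
  have := Perm.sameCycle_inv.1 hxy
  rwa [Perm.sameCycle_apply_left, Perm.sameCycle_apply_right] at this

/-- Reflection in the vertical axis. -/
theorem IsHHDrawing.mirror {σ τ : Perm E} {pA pB : E → ℝ × ℝ} (h : IsHHDrawing σ τ pA pB) :
    IsHHDrawing σ⁻¹ τ⁻¹ (fun x => (-(pA x).1, (pA x).2)) (fun x => (-(pB x).1, (pB x).2)) := by
  have ht : ∀ x, tilt (-(pA x).1, (pA x).2) (-(pB x).1, (pB x).2) = - tilt (pA x) (pB x) := by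
    intro x
    simp only [tilt]
    ring
  have hinv : ∀ (ρ : Perm E) (p : E → ℝ × ℝ), (∀ x, p (ρ x) = p x) → ∀ x, p (ρ⁻¹ x) = p x := by
    intro ρ p hp x
    conv_rhs => rw [← ρ.apply_symm_apply x]
    rw [hp]
    rfl
  have hmem : ∀ x (q : ℝ × ℝ), q ∈ segment ℝ (-(pA x).1, (pA x).2) (-(pB x).1, (pB x).2) →
      (-q.1, q.2) ∈ segment ℝ (pA x) (pB x) := by
    intro x q hq
    rw [mem_segment_iff_tilt (h.lt x x)]
    rw [mem_segment_iff_tilt (a := (-(pA x).1, (pA x).2)) (b := (-(pB x).1, (pB x).2))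
      (h.lt x x), ht] at hq
    refine ⟨?_, hq.2⟩
    have := hq.1
    simp only at this ⊢
    linarith
  refine ⟨fun x => ?_, fun x => ?_, h.top_pos, h.bottom_neg, ?_, h.top_mono.inv ht,
    h.bottom_mono.inv ht⟩
  · simp only [hinv _ _ h.top_apply]
  · simp only [hinv _ _ h.bottom_apply]
  · intro x y q hx hy
    have := h.planar x y _ (hmem x q hx) (hmem y q hy)
    simp only [Perm.sameCycle_inv]
    refine this.imp (And.imp_right fun h => ?_) (Or.imp (And.imp_right fun h => ?_) id)
    · rw [← h]; simp
    · rw [← h]; simp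

/-- Rotation by half a turn. -/
theorem IsHHDrawing.rotate {σ τ : Perm E} {pA pB : E → ℝ × ℝ} (h : IsHHDrawing σ τ pA pB) :
    IsHHDrawing τ σ (fun x => -(pB x)) (fun x => -(pA x)) := by
  have ht : ∀ x, tilt (-(pB x)) (-(pA x)) = tilt (pA x) (pB x) := by
    intro x
    simp only [tilt, Prod.fst_neg, Prod.snd_neg]
    congr 1 <;> ring
  have hmem : ∀ x (q : ℝ × ℝ), q ∈ segment ℝ (-(pB x)) (-(pA x)) →
      -q ∈ segment ℝ (pA x) (pB x) := by
    intro x q hq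
    have hl := h.lt x x
    have hm := tilt_mul hl
    rw [mem_segment_iff_tilt hl]
    rw [mem_segment_iff_tilt (by simpa using hl), ht] at hq
    simp only [Prod.fst_neg, Prod.snd_neg] at hq ⊢
    refine ⟨?_, by linarith, by linarith⟩
    linear_combination hm - hq.1
  refine ⟨fun x => ?_, fun x => ?_, fun x => ?_, fun x => ?_, ?_, ?_, ?_⟩
  · simp only [h.bottom_apply]
  · simp only [h.top_apply]
  · simpa using h.bottom_neg x
  · simpa using h.top_pos x
  · intro x y q hx hy
    rcases h.planar x y _ (hmem x q hx) (hmem y q hy) with h1 | h1 | h1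
    · exact Or.inr (Or.inl ⟨h1.1, by rw [← h1.2, neg_neg]⟩)
    · exact Or.inl ⟨h1.1, by rw [← h1.2, neg_neg]⟩
    · exact Or.inr (Or.inr h1.symm)
  · simpa only [ht] using h.bottom_mono
  · simpa only [ht] using h.top_mono

end Drawing

section Split

variable {E : Type}

/-- The lower ends of the edges after the edges at `e` have been detached from the lower vertex they
share and moved to a new vertex nearby. -/
noncomputable def shiftBottom (τ : Perm E) (e : E) (c : ℝ) (pB : E → ℝ × ℝ) (ε : ℝ) (x : E) :
    ℝ × ℝ :=
  open scoped Classical in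
  if τ.SameCycle e x then ((pB x).1 - ε * c, (pB x).2 + ε) else pB x

theorem shiftBottom_of_sameCycle {τ : Perm E} {e x : E} (h : τ.SameCycle e x) (c : ℝ)
    (pB : E → ℝ × ℝ) (ε : ℝ) :
    shiftBottom τ e c pB ε x = ((pB x).1 - ε * c, (pB x).2 + ε) := by
  rw [shiftBottom, if_pos h]

theorem shiftBottom_of_not_sameCycle {τ : Perm E} {e x : E} (h : ¬ τ.SameCycle e x) (c : ℝ)
    (pB : E → ℝ × ℝ) (ε : ℝ) : shiftBottom τ e c pB ε x = pB x := by
  rw [shiftBottom, if_neg h]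

theorem continuous_shiftBottom (τ : Perm E) (e : E) (c : ℝ) (pB : E → ℝ × ℝ) (x : E) :
    Continuous fun ε => shiftBottom τ e c pB ε x := by
  by_cases h : τ.SameCycle e x
  · simp only [shiftBottom_of_sameCycle h]
    fun_prop
  · simp only [shiftBottom_of_not_sameCycle h]
    fun_prop

theorem shiftBottom_zero (τ : Perm E) (e : E) (c : ℝ) (pB : E → ℝ × ℝ) (x : E) :
    shiftBottom τ e c pB 0 x = pB x := by
  by_cases h : τ.SameCycle e x
  · simp [shiftBottom_of_sameCycle h]
  · simp [shiftBottom_of_not_sameCycle h]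

/-- The points of a segment lie weakly on the side of a line given by its ends. -/
theorem line_segment_eq {a b q : ℝ × ℝ} (h : b.2 < a.2) (hq : q ∈ segment ℝ a b) (α β : ℝ) :
    (q.1 + α * q.2 - β) * (a.2 - b.2) =
      (a.1 + α * a.2 - β) * (q.2 - b.2) + (b.1 + α * b.2 - β) * (a.2 - q.2) := by
  have h1 := ((mem_segment_iff_tilt h).1 hq).1
  have h2 := tilt_mul h
  linear_combination (a.2 - b.2) * h1 - (q.2 - b.2) * h2

theorem tilt_shift {a b : ℝ × ℝ} {c ε : ℝ} (h : b.2 < a.2) (h' : b.2 + ε < a.2) :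
    (tilt a (b.1 - ε * c, b.2 + ε) - tilt a b) * (a.2 - (b.2 + ε)) = ε * (tilt a b - c) := by
  have h1 := tilt_mul h
  have h2 := tilt_mul (a := a) (b := (b.1 - ε * c, b.2 + ε)) h'
  simp only at h2
  linear_combination h2 - h1

theorem tendsto_tilt {a : ℝ × ℝ} {b : ℝ → ℝ × ℝ} (hb : Continuous b) (h : (b 0).2 < a.2) :
    Tendsto (fun ε => tilt a (b ε)) (𝓝 0) (𝓝 (tilt a (b 0))) := by
  have : ContinuousAt (fun ε => tilt a (b ε)) 0 := by
    unfold tilt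
    refine ContinuousAt.div (by fun_prop) (by fun_prop) ?_
    exact (sub_pos.2 h).ne'
  exact this

theorem exists_gap [Finite E] (s : E → ℝ) (r : ℝ) : ∃ c, r < c ∧ ∀ x, s x ≤ r ∨ c < s x := by
  have : ∀ᶠ c in 𝓝[>] r, r < c ∧ ∀ x, s x ≤ r ∨ c < s x := by
    refine (eventually_mem_nhdsWithin).and (eventually_all.2 fun x => ?_)
    rcases le_or_gt (s x) r with h | h
    · exact Eventually.of_forall fun c => Or.inl h
    · exact (eventually_nhdsWithin_of_eventually_nhds (eventually_lt_nhds h)).mono fun c => Or.inr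
  exact this.exists

theorem IsHHDrawing.split_of_no_descent [Finite E] [DecidableEq E] {σ τ : Perm E} {e p : E} {pA pB : E → ℝ × ℝ}
    (h : IsHHDrawing σ (merge σ τ e) pA pB)
    (hb : Bundled σ τ) (hb' : Bundled σ (merge σ τ e))
    (hne : ¬ τ.SameCycle e (σ e)) (hp : τ p = e)
    (hs : ∀ x, τ.SameCycle e x → x ≠ p → tilt (pA x) (pB x) ≤ tilt (pA (τ x)) (pB (τ x))) :
    ∃ pB', IsHHDrawing σ τ pA pB' := by
  set m := merge σ τ e with hm
  set s : E → ℝ := fun x => tilt (pA x) (pB x) with hsdef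
  have hK0 : ∀ x y, σ.SameCycle x y → m.SameCycle x y → s x = s y := by
    intro x y h1 h2
    simp only [hsdef, h.top_eq h1, h.bottom_eq h2]
  have hse : s (σ e) = s e := by
    refine (hK0 e (σ e) (Perm.sameCycle_apply_right.2 (.refl _ _)) ?_).symm
    exact (merge_sameCycle_iff hne).2 (Or.inr (Or.inl ⟨.refl _ _, .refl _ _⟩))
  have hK1 : ∀ x y, σ.SameCycle x y → s x = s y → m.SameCycle x y :=
    fun x y => h.bottom_sameCycle_of_tilt_eq
  have hK2 : ∀ x y, m.SameCycle x y → s x = s y → σ.SameCycle x y :=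
    fun x y => h.top_sameCycle_of_tilt_eq
  obtain ⟨c, hc, hgap⟩ := exists_gap s (s e)
  have hev : ∀ᶠ ε in 𝓝[>] (0 : ℝ), 0 < ε ∧ (∀ x, (shiftBottom τ e c pB ε x).2 < 0) ∧
      (∀ x y, s x < s y → tilt (pA x) (shiftBottom τ e c pB ε x) <
        tilt (pA y) (shiftBottom τ e c pB ε y)) ∧
      (∀ x y, Disjoint (segment ℝ (pA x) (pB x)) (segment ℝ (pA y) (pB y)) →
        Disjoint (segment ℝ (pA x) (shiftBottom τ e c pB ε x)) (segment ℝ (pA y) (pB y))) := by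
    refine eventually_mem_nhdsWithin.and
      (eventually_nhdsWithin_of_eventually_nhds (.and ?_ (.and ?_ ?_)))
    · refine eventually_all.2 fun x => ?_
      have := (continuous_snd.comp (continuous_shiftBottom τ e c pB x)).tendsto 0
      refine this.eventually_lt_const ?_
      simpa [shiftBottom_zero] using h.bottom_neg x
    · refine eventually_all.2 fun x => eventually_all.2 fun y => ?_
      by_cases hxy : s x < s y
      · refine Eventually.mono ?_ fun ε hε _ => hε
        refine Tendsto.eventually_lt (tendsto_tilt (continuous_shiftBottom τ e c pB x) ?_)
          (tendsto_tilt (continuous_shiftBottom τ e c pB y) ?_) ?_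
        · rw [shiftBottom_zero]; exact h.lt _ _
        · rw [shiftBottom_zero]; exact h.lt _ _
        · rw [shiftBottom_zero, shiftBottom_zero]; exact hxy
      · exact Eventually.of_forall fun ε h => absurd h hxy
    · refine eventually_all.2 fun x => eventually_all.2 fun y => ?_
      by_cases hxy : Disjoint (segment ℝ (pA x) (pB x)) (segment ℝ (pA y) (pB y))
      · refine Eventually.mono ?_ fun ε hε _ => hε
        refine eventually_disjoint_segment (continuous_shiftBottom τ e c pB x)
          (isCompact_segment _ _).isClosed ?_
        rwa [shiftBottom_zero]
      · exact Eventually.of_forall fun ε h => absurd h hxy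
  obtain ⟨ε, hε, hneg, h2, hdisj⟩ := hev.exists
  set Q := shiftBottom τ e c pB ε with hQ
  set s' : E → ℝ := fun x => tilt (pA x) (Q x) with hs'
  have hlt : ∀ x y, (Q x).2 < (pA y).2 := fun x y => (hneg x).trans (h.top_pos y)
  have hQM : ∀ {x}, τ.SameCycle e x → Q x = ((pB x).1 - ε * c, (pB x).2 + ε) := fun hx =>
    shiftBottom_of_sameCycle hx c pB ε
  have hQN : ∀ {x}, ¬ τ.SameCycle e x → Q x = pB x := fun hx =>
    shiftBottom_of_not_sameCycle hx c pB ε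
  have h1 : ∀ x, ¬ τ.SameCycle e x → s' x = s x := fun x hx => by
    simp only [hs', hsdef, hQN hx]
  have hdiff : ∀ x, τ.SameCycle e x → (s' x - s x) * ((pA x).2 - (Q x).2) = ε * (s x - c) := by
    intro x hx
    have h3 := hlt x x
    simp only [hs', hsdef]
    rw [hQM hx] at h3 ⊢
    exact tilt_shift (h.lt x x) h3
  have h3 : ∀ x y, τ.SameCycle e x → τ.SameCycle e y → σ.SameCycle x y → s x = s y →
      s' x = s' y := by
    intro x y hx hy hxy _
    simp only [hs', hQM hx, hQM hy, h.top_eq hxy]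
    have : m.SameCycle x y := (merge_sameCycle_iff hne).2 (Or.inl (hx.symm.trans hy))
    rw [h.bottom_eq this]
  have h4 : ∀ x, τ.SameCycle e x → s e < s x → s x < s' x := by
    intro x hx hex
    have h5 := hdiff x hx
    have h6 := hlt x x
    have h7 : c < s x := (hgap x).resolve_left (not_le.2 hex)
    by_contra! hle
    nlinarith [mul_pos hε (sub_pos.2 h7), mul_nonneg (sub_nonneg.2 hle) (sub_pos.2 h6).le]
  have h5 : ∀ x, τ.SameCycle e x → s x = s e → s' x < s x := by
    intro x hx hex
    have h5 := hdiff x hx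
    have h6 := hlt x x
    have h7 : s x < c := hex ▸ hc
    by_contra! hle
    nlinarith [mul_pos hε (sub_pos.2 h7), mul_nonneg (sub_nonneg.2 hle) (sub_pos.2 h6).le]
  have hrange : ∀ {x}, τ.SameCycle e x → s e ≤ s x ∧ s x ≤ s p := fun hx =>
    mem_range_of_no_descent hp hs hx
  have hne' : ∀ x, τ.SameCycle e x → s' x ≠ s x := by
    intro x hx
    rcases (hrange hx).1.eq_or_lt with h6 | h6
    · exact (h5 x hx h6.symm).ne
    · exact (h4 x hx h6).ne'
  have hapex : ∀ x y, σ.SameCycle x y → s' x ≠ s' y → ∀ q ∈ segment ℝ (pA x) (Q x),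
      q ∈ segment ℝ (pA y) (Q y) → q = pA x := by
    intro x y hxy hss q hx hy
    rw [h.top_eq hxy] at hy
    refine eq_top_of_mem_segments (hlt x x) (hlt y x) ?_ hx hy
    have hss' : tilt (pA x) (Q x) ≠ tilt (pA y) (Q y) := hss
    rwa [h.top_eq hxy] at hss'
  have cross : ∀ x y, τ.SameCycle e x → ¬ τ.SameCycle e y → ∀ q ∈ segment ℝ (pA x) (Q x),
      q ∈ segment ℝ (pA y) (Q y) → σ.SameCycle x y ∧ q = pA x := by
    intro x y hx hy q hqx hqy
    by_cases hxy : σ.SameCycle x y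
    · refine ⟨hxy, hapex x y hxy ?_ q hqx hqy⟩
      rcases lt_trichotomy (s x) (s y) with h6 | h6 | h6
      · exact (h2 x y h6).ne
      · rw [h1 y hy, ← h6]
        exact hne' x hx
      · exact (h2 y x h6).ne'
    · exfalso
      rw [hQN hy] at hqy
      by_cases hmxy : m.SameCycle x y
      · have hsne : s x ≠ s y := fun h6 => hxy (hK2 x y hmxy h6)
        have hy2 : τ.SameCycle (σ e) y := by
          rcases (merge_sameCycle_iff hne).1 hmxy with h6 | h6 | h6
          · exact absurd (hx.trans h6) hy
          · exact h6.2
          · exact absurd h6.2 hy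
        have hB := h.bottom_eq hmxy
        have hA := (mem_segment_iff_tilt (h.lt y y)).1 hqy
        have hx1 := hlt x x
        have hx2 := h.lt x x
        have hx3 := tilt_mul hx2
        have hx4 := (mem_segment_iff_tilt hx1).1 hqx
        have hline := fun α => line_segment_eq hx1 hqx α ((pB x).1 + α * (pB x).2)
        change q.1 + s y * q.2 = (pB y).1 + s y * (pB y).2 ∧ _ at hA
        change s x * _ = _ at hx3
        rw [hQM hx] at hline hx1 hx4
        rw [hB] at hA
        simp only at hline hx1 hx4
        obtain ⟨hA1, hA2, hA3⟩ := hA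
        obtain ⟨-, hx5, hx6⟩ := hx4
        have hr := hrange hx
        by_cases h7 : s y ≤ s e
        · have h8 := hline (s e)
          have h9 : q.1 + s e * q.2 - ((pB x).1 + s e * (pB x).2) =
            (s e - s y) * (q.2 - (pB x).2) := by linear_combination hA1
          have h10 : (pA x).1 + s e * (pA x).2 - ((pB x).1 + s e * (pB x).2) =
            (s e - s x) * ((pA x).2 - (pB x).2) := by linear_combination hx3
          rw [h9, h10] at h8
          have h11 : (s e - s x) * ((pA x).2 - (pB x).2) * (q.2 - ((pB x).2 + ε)) ≤ 0 :=
            mul_nonpos_of_nonpos_of_nonneg (mul_nonpos_of_nonpos_of_nonneg (by linarith)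
              (by linarith)) (by linarith)
          have h12 : 0 ≤ (s e - s y) * (q.2 - (pB x).2) :=
            mul_nonneg (by linarith) (by linarith)
          have h13 : 0 ≤ (s e - s y) * (q.2 - (pB x).2) * ((pA x).2 - ((pB x).2 + ε)) :=
            mul_nonneg h12 (by linarith)
          have h14 : q.2 = (pA x).2 := by
            by_contra h15
            have h16 : q.2 < (pA x).2 := lt_of_le_of_ne hx6 h15
            nlinarith [mul_pos (mul_pos hε (sub_pos.2 hc)) (sub_pos.2 h16)]
          have h17 : s e = s x ∧ s e = s y := by
            rw [h14] at h8
            have h18 : (0 : ℝ) < (pA x).2 - ((pB x).2 + ε) := by linarith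
            have h19 : 0 < (pA x).2 - (pB x).2 := by linarith
            have h20 : (s e - s y) * ((pA x).2 - (pB x).2) =
              (s e - s x) * ((pA x).2 - (pB x).2) := by
              apply mul_right_cancel₀ h18.ne'
              linear_combination h8
            have h21 := mul_right_cancel₀ h19.ne' h20
            constructor <;> linarith
          exact hsne (h17.1.symm.trans h17.2)
        · have h8 := hline (s y)
          have h9 : q.1 + s y * q.2 - ((pB x).1 + s y * (pB x).2) = 0 := by
            linear_combination hA1
          have h10 : (pA x).1 + s y * (pA x).2 - ((pB x).1 + s y * (pB x).2) =
            (s y - s x) * ((pA x).2 - (pB x).2) := by linear_combination hx3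
          rw [h9, h10] at h8
          have h11 : c < s y := (hgap y).resolve_left h7
          have h12 : s x < s y := by
            refine lt_of_le_of_ne (hr.2.trans ?_) hsne
            exact (le_or_le_of_no_descent hne hp h.bottom_mono hse hy2).resolve_left h7
          have h13 := mul_pos (sub_pos.2 h12) (sub_pos.2 hx2)
          have h14 := mul_pos hε (sub_pos.2 h11)
          have h15 := mul_nonneg h13.le (sub_nonneg.2 hx5)
          have h16 := mul_nonneg h14.le (sub_nonneg.2 hx6)
          rcases hx6.eq_or_lt with h17 | h17
          · have h18 := mul_pos h13 (sub_pos.2 hx1)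
            rw [h17] at h8
            linarith
          · have h18 := mul_pos h14 (sub_pos.2 h17)
            linarith
      · refine Set.disjoint_left.1 (hdisj x y ?_) hqx hqy
        rw [Set.disjoint_left]
        intro z hzx hzy
        rcases h.planar x y z hzx hzy with h6 | h6 | h6
        · exact hxy h6.1
        · exact hmxy h6.1
        · exact hxy h6.1
  refine ⟨Q, h.top_apply, fun x => ?_, h.top_pos, hneg, ?_, ?_, ?_⟩
  · have hsame : m.SameCycle x (τ x) :=
      (merge_sameCycle_iff hne).2 (Or.inl (Perm.sameCycle_apply_right.2 (.refl _ _)))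
    by_cases hx : τ.SameCycle e x
    · rw [hQM hx, hQM (Perm.sameCycle_apply_right.2 hx), h.bottom_eq hsame]
    · rw [hQN hx, hQN (fun h6 => hx (Perm.sameCycle_apply_right.1 h6)), h.bottom_eq hsame]
  · intro x y q hqx hqy
    by_cases hx : τ.SameCycle e x <;> by_cases hy : τ.SameCycle e y
    · have hxy : τ.SameCycle x y := hx.symm.trans hy
      by_cases hσ : σ.SameCycle x y
      · exact Or.inr (Or.inr ⟨hσ, hxy⟩)
      · refine Or.inr (Or.inl ⟨hxy, ?_⟩)
        have hmxy : m.SameCycle x y := (merge_sameCycle_iff hne).2 (Or.inl hxy)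
        have hQQ : Q y = Q x := by rw [hQM hx, hQM hy, h.bottom_eq hmxy]
        have hss : s' x ≠ s' y := by
          have h6 : s x ≠ s y := fun h6 => hσ (hK2 x y hmxy h6)
          rcases h6.lt_or_gt with h7 | h7
          · exact (h2 x y h7).ne
          · exact (h2 y x h7).ne'
        simp only [hs', hQQ] at hss
        rw [hQQ] at hqy
        exact eq_bottom_of_mem_segments (hlt x x) (hlt x y) hss hqx hqy
    · exact Or.inl (cross x y hx hy q hqx hqy)
    · obtain ⟨h6, h7⟩ := cross y x hy hx q hqy hqx
      exact Or.inl ⟨h6.symm, h7.trans (h.top_eq h6).symm⟩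
    · rw [hQN hx] at hqx ⊢
      rw [hQN hy] at hqy
      have hmτ : m.SameCycle x y → τ.SameCycle x y := by
        intro h6
        rcases (merge_sameCycle_iff hne).1 h6 with h6 | h6 | h6
        · exact h6
        · exact absurd h6.1 hx
        · exact absurd h6.2 hy
      exact (h.planar x y q hqx hqy).imp id (Or.imp (And.imp_left hmτ) (And.imp_right hmτ))
  · exact isCyclicMono_split_top hb hb' hne hp h.top_mono hs hK0 hK1 hK2 h1 h2 h3 h4 h5
  · exact isCyclicMono_split_bottom hne hp h.bottom_mono hse hs hK2 h1 h2 h3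

theorem merge_inv [DecidableEq E] (σ τ : Perm E) (e : E) :
    (merge σ τ e)⁻¹ = merge σ⁻¹ τ⁻¹ (σ e) := by
  have h1 : σ⁻¹ (σ e) = e := σ.symm_apply_apply e
  have h2 : τ (τ⁻¹ e) = e := τ.apply_symm_apply e
  simp only [merge, mul_inv_rev, swap_inv, swap_mul_eq_mul_swap, inv_inv, h1, h2]
  rw [swap_comm]

theorem tilt_mirror (a b : ℝ × ℝ) : tilt (-a.1, a.2) (-b.1, b.2) = - tilt a b := by
  simp only [tilt]
  ring

theorem IsHHDrawing.split [Finite E] [DecidableEq E] {σ τ : Perm E} {e : E} {pA pB : E → ℝ × ℝ}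
    (h : IsHHDrawing σ (merge σ τ e) pA pB)
    (hb : Bundled σ τ) (hb' : Bundled σ (merge σ τ e))
    (hne : ¬ τ.SameCycle e (σ e)) :
    ∃ pA' pB', IsHHDrawing σ τ pA' pB' := by
  by_cases hs : ∀ x, τ.SameCycle e x → x ≠ τ⁻¹ e →
      tilt (pA x) (pB x) ≤ tilt (pA (τ x)) (pB (τ x))
  · exact ⟨pA, h.split_of_no_descent hb hb' hne (τ.apply_symm_apply e) hs⟩
  · push Not at hs
    obtain ⟨u, hu, hup, hdesc⟩ := hs
    have hτu : τ u ≠ e := fun h1 => hup (by rw [← h1]; exact (τ.symm_apply_apply u).symm)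
    have hmu : merge σ τ e u = τ u :=
      merge_apply_of_ne _ _ _ (fun h1 => hne (h1 ▸ hu)) hτu
    have hs' : ∀ y, τ.SameCycle (σ e) y → y ≠ σ e →
        tilt (pA y) (pB y) ≤ tilt (pA (τ y)) (pB (τ y)) := by
      intro y hy hye
      by_contra! hlt
      have hmy : merge σ τ e y = τ y := by
        refine merge_apply_of_ne _ _ _ hye fun h1 => hne ?_
        have h2 := Perm.sameCycle_apply_right.2 hy
        rw [h1] at h2
        exact h2.symm
      have huy : u = y := by
        refine h.bottom_mono u y ((merge_sameCycle_iff hne).2 (Or.inr (Or.inl ⟨hu, hy⟩))) ?_ ?_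
        · rw [hmu]; exact hdesc
        · rw [hmy]; exact hlt
      exact hne (hu.trans (huy ▸ hy.symm))
    have h1 : σ⁻¹ (σ e) = e := σ.symm_apply_apply e
    have h2 := h.mirror
    rw [merge_inv] at h2
    have hb2 := hb'.inv
    rw [merge_inv] at hb2
    obtain ⟨pB', h3⟩ := h2.split_of_no_descent (p := τ (σ e)) hb.inv hb2
      (by rw [h1, Perm.sameCycle_inv]; exact fun h => hne h.symm)
      (τ.symm_apply_apply _) (by
        intro x hx hxp
        obtain ⟨y, rfl⟩ := τ.surjective x
        have h4 : τ⁻¹ (τ y) = y := τ.symm_apply_apply y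
        rw [Perm.sameCycle_inv, Perm.sameCycle_apply_right] at hx
        rw [h4, tilt_mirror, tilt_mirror, neg_le_neg_iff]
        exact hs' y hx fun h5 => hxp (by rw [h5]))
    exact ⟨_, _, by simpa only [inv_inv] using h3.mirror⟩

/-- Two rotation systems with the same orbits, traversed in opposite directions. -/
theorem exists_isHHDrawing_of_mul_eq_one [Finite E] {σ τ : Perm E} (h : τ * σ = 1) :
    ∃ pA pB, IsHHDrawing σ τ pA pB := by
  obtain rfl : τ = σ⁻¹ := eq_inv_of_mul_eq_one_left h
  obtain ⟨n, ⟨φ⟩⟩ := Finite.exists_equiv_fin (Quotient (Perm.SameCycle.setoid σ))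
  set k : E → ℝ := fun x => ((φ (Quotient.mk (Perm.SameCycle.setoid σ) x) : ℕ) : ℝ) with hk
  have key : ∀ x y, k x = k y ↔ σ.SameCycle x y := by
    intro x y
    simp only [hk, Nat.cast_inj, Fin.val_inj, φ.apply_eq_iff_eq]
    exact Quotient.eq
  have ht : ∀ x, tilt (k x, 1) (k x, -1) = 0 := by
    intro x
    simp [tilt]
  refine ⟨fun x => (k x, 1), fun x => (k x, -1), ?_, ?_, fun x => ?_, fun x => ?_, ?_, ?_, ?_⟩
  · intro x
    rw [(key (σ x) x).2 (Perm.sameCycle_apply_left.2 (.refl _ _))]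
  · intro x
    rw [(key (σ⁻¹ x) x).2 (Perm.sameCycle_symm_apply_left.2 (.refl _ _))]
  · norm_num
  · norm_num
  · intro x y q hx hy
    have hl : ((k x, -1) : ℝ × ℝ).2 < ((k x, 1) : ℝ × ℝ).2 := by norm_num
    have h1 := ((mem_segment_iff_tilt hl).1 hx).1
    have h2 := ((mem_segment_iff_tilt (a := (k y, 1)) (b := (k y, -1)) hl).1 hy).1
    rw [ht] at h1 h2
    have h3 : σ.SameCycle x y := by
      rw [← key]
      simp only at h1 h2
      linarith
    exact Or.inr (Or.inr ⟨h3, Perm.sameCycle_inv.2 h3⟩)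
  · intro x y _ h1
    simp only [ht, lt_self_iff_false] at h1
  · intro x y _ h1
    simp only [ht, lt_self_iff_false] at h1

theorem exists_isHHDrawing [Fintype E] [DecidableEq E] (n : ℕ) (σ τ : Perm E)
    (hn : (τ * σ).support.card = n) (hP : HasPotentials σ τ) (hB : Bundled σ τ) :
    ∃ pA pB, IsHHDrawing σ τ pA pB := by
  induction n using Nat.strong_induction_on generalizing σ τ with
  | _ n ih =>
    have step : ∀ σ τ : Perm E, (τ * σ).support.card = n → HasPotentials σ τ → Bundled σ τ →
        ∀ e, IsGoodCorner σ τ e → ∃ pA pB, IsHHDrawing σ τ pA pB := by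
      intro σ τ hn hP hB e he
      have hB' := hB.merge he
      have hφ := face_ne_self_of_not_sameCycle he.1
      have hσ : σ e ≠ e := fun h => he.1 (by rw [h])
      obtain ⟨pA, pB, h⟩ := ih _ (hn ▸ card_support_merge_lt he.1) σ _ rfl (hP.merge hσ hφ) hB'
      exact h.split hB hB' he.1
    by_cases hne : τ * σ = 1
    · exact exists_isHHDrawing_of_mul_eq_one hne
    · rcases exists_isGoodCorner hP hB hne with ⟨e, he⟩ | ⟨e, he⟩
      · exact step σ τ hn hP hB e he
      · have hn' : (σ * τ).support.card = n := by
          rw [← hn, show σ * τ = σ * (τ * σ) * σ⁻¹ by group, Perm.card_support_conj]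
        obtain ⟨pA, pB, h⟩ := step τ σ hn' hP.symm hB.symm e he
        exact ⟨_, _, h.rotate⟩

end Split

section Layout

variable {V E : Type}

/-- The slope of the segment of an edge with left end `l e` and right end `r e`. -/
noncomputable def edgeSlope (X Y : V → ℝ) (l r : E → V) (e : E) : ℝ :=
  (Y (r e) - Y (l e)) / (X (r e) - X (l e))

/-- The height at abscissa `t` of the line through an edge. -/
noncomputable def edgeHeight (X Y : V → ℝ) (l r : E → V) (e : E) (t : ℝ) : ℝ :=
  Y (l e) + edgeSlope X Y l r e * (t - X (l e))

/-- A planar straight-line layout with pairwise distinct abscissae, `l` and `r` giving the left and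
right ends of the edges. -/
structure IsLayout (X Y : V → ℝ) (l r : E → V) : Prop where
  inj : Function.Injective X
  lt : ∀ e, X (l e) < X (r e)
  planar : ∀ e g, e ≠ g → ∀ t, X (l e) ≤ t → t ≤ X (r e) → X (l g) ≤ t → t ≤ X (r g) →
    edgeHeight X Y l r e t = edgeHeight X Y l r g t →
    ∃ w, (w = l e ∨ w = r e) ∧ (w = l g ∨ w = r g) ∧ t = X w

/-- The edge `g` runs strictly below the vertex `v`. -/
def RunsBelow (X Y : V → ℝ) (l r : E → V) (g : E) (v : V) : Prop :=
  X (l g) < X v ∧ X v < X (r g) ∧ edgeHeight X Y l r g (X v) < Y v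

/-- The vertex `v` lies strictly below the edge `e`. -/
def LiesBelow (X Y : V → ℝ) (l r : E → V) (e : E) (v : V) : Prop :=
  X (l e) < X v ∧ X v < X (r e) ∧ Y v < edgeHeight X Y l r e (X v)

/-- The edge `g` runs strictly below the edge `e` somewhere. -/
def IsUnder (X Y : V → ℝ) (l r : E → V) (g e : E) : Prop :=
  ∃ t, X (l e) < t ∧ t < X (r e) ∧ X (l g) < t ∧ t < X (r g) ∧
    edgeHeight X Y l r g t < edgeHeight X Y l r e t

variable {X Y : V → ℝ} {l r : E → V}

theorem edgeHeight_left (e : E) : edgeHeight X Y l r e (X (l e)) = Y (l e) := by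
  simp [edgeHeight]

theorem edgeSlope_mirror (e : E) : edgeSlope (fun v => -X v) Y r l e = - edgeSlope X Y l r e := by
  simp only [edgeSlope]
  rw [← neg_sub (Y (r e)), show -X (l e) - -X (r e) = X (r e) - X (l e) by ring, neg_div]

theorem IsLayout.edgeHeight_mirror (h : IsLayout X Y l r) (e : E) (t : ℝ) :
    edgeHeight (fun v => -X v) Y r l e t = edgeHeight X Y l r e (-t) := by
  have h1 : edgeSlope X Y l r e * (X (r e) - X (l e)) = Y (r e) - Y (l e) :=
    div_mul_cancel₀ _ (sub_pos.2 (h.lt e)).ne'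
  simp only [edgeHeight, edgeSlope_mirror]
  linear_combination -h1

theorem IsLayout.mirror (h : IsLayout X Y l r) : IsLayout (fun v => -X v) Y r l where
  inj := fun _ _ huv => h.inj (neg_injective huv)
  lt := fun e => neg_lt_neg (h.lt e)
  planar := by
    intro e g hne t h1 h2 h3 h4 h5
    rw [h.edgeHeight_mirror, h.edgeHeight_mirror] at h5
    obtain ⟨w, hw1, hw2, hw3⟩ := h.planar e g hne (-t) (by linarith) (by linarith) (by linarith)
      (by linarith) h5
    exact ⟨w, hw1.symm, hw2.symm, by rw [← hw3, neg_neg]⟩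

theorem IsLayout.runsBelow_mirror (h : IsLayout X Y l r) (g : E) (v : V) :
    RunsBelow (fun v => -X v) Y r l g v ↔ RunsBelow X Y l r g v := by
  simp only [RunsBelow, h.edgeHeight_mirror, neg_neg, neg_lt_neg_iff]
  tauto

theorem IsLayout.liesBelow_mirror (h : IsLayout X Y l r) (g : E) (v : V) :
    LiesBelow (fun v => -X v) Y r l g v ↔ LiesBelow X Y l r g v := by
  simp only [LiesBelow, h.edgeHeight_mirror, neg_neg, neg_lt_neg_iff]
  tauto

theorem IsLayout.isUnder_mirror (h : IsLayout X Y l r) (g e : E) :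
    IsUnder (fun v => -X v) Y r l g e ↔ IsUnder X Y l r g e := by
  simp only [IsUnder, h.edgeHeight_mirror]
  constructor
  · rintro ⟨t, h1, h2, h3, h4, h5⟩
    exact ⟨-t, by linarith, by linarith, by linarith, by linarith, h5⟩
  · rintro ⟨t, h1, h2, h3, h4, h5⟩
    exact ⟨-t, by linarith, by linarith, by linarith, by linarith, by rwa [neg_neg]⟩

/-- Comparing heights at one point of an open interval without crossings and at its left end. -/
theorem IsLayout.height_lt_of_lt (h : IsLayout X Y l r) {g e : E} (hne : g ≠ e) {t₀ t : ℝ}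
    (h1 : X (l e) ≤ t₀) (h2 : X (l g) ≤ t₀) (h12 : X (l e) ≠ X (l g)) (h3 : t₀ < t)
    (h4 : t < X (r e)) (h5 : t < X (r g))
    (hlt : edgeHeight X Y l r g t < edgeHeight X Y l r e t) :
    edgeHeight X Y l r g t₀ < edgeHeight X Y l r e t₀ := by
  by_contra! hle
  have hc : ∀ e, Continuous (edgeHeight X Y l r e) := fun e => by
    unfold edgeHeight
    fun_prop
  obtain ⟨z, hz, hz'⟩ := intermediate_value_Icc' h3.le
    ((hc g).sub (hc e)).continuousOn (show (0 : ℝ) ∈ Icc _ _ from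
      ⟨(sub_neg.2 hlt).le, sub_nonneg.2 hle⟩)
  obtain ⟨w, hw1, hw2, hw3⟩ := h.planar g e hne z (h2.trans hz.1) (hz.2.trans h5.le)
    (h1.trans hz.1) (hz.2.trans h4.le) (sub_eq_zero.1 hz')
  have hz2 := hz.2
  have : w = l g := hw1.resolve_right (by rintro rfl; linarith)
  have : w = l e := hw2.resolve_right (by rintro rfl; linarith)
  exact h12 (by rw [← this, ‹w = l g›])

theorem exists_gt_height_lt {g e : E} {t₀ t₁ : ℝ} (h : t₀ < t₁)
    (hlt : edgeHeight X Y l r g t₀ < edgeHeight X Y l r e t₀) :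
    ∃ t, t₀ < t ∧ t < t₁ ∧ edgeHeight X Y l r g t < edgeHeight X Y l r e t := by
  have hc : ∀ e, Continuous (edgeHeight X Y l r e) := fun e => by
    unfold edgeHeight
    fun_prop
  have h1 : ∀ᶠ t in nhdsWithin t₀ (Ioi t₀),
      edgeHeight X Y l r g t < edgeHeight X Y l r e t :=
    eventually_nhdsWithin_of_eventually_nhds
      ((hc g).continuousAt.eventually_lt (hc e).continuousAt hlt)
  have h2 : ∀ᶠ t in nhdsWithin t₀ (Ioi t₀), t ∈ Ioo t₀ t₁ := Ioo_mem_nhdsGT h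
  obtain ⟨t, ht1, ht2⟩ := (h1.and h2).exists
  exact ⟨t, ht2.1, ht2.2, ht1⟩

theorem IsLayout.left_iff (h : IsLayout X Y l r) {g e : E} (hne : g ≠ e) :
    (RunsBelow X Y l r g (l e) ∨ (l g = l e ∧ edgeSlope X Y l r g < edgeSlope X Y l r e) ∨
      LiesBelow X Y l r e (l g)) ↔ IsUnder X Y l r g e := by
  constructor
  · rintro (⟨h1, h2, h3⟩ | ⟨h1, h2⟩ | ⟨h1, h2, h3⟩)
    · rw [← edgeHeight_left (X := X) (Y := Y) (l := l) (r := r) e] at h3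
      obtain ⟨t, ht1, ht2, ht3⟩ := exists_gt_height_lt (lt_min h2 (h.lt e)) h3
      exact ⟨t, ht1, ht2.trans_le (min_le_right _ _), h1.trans ht1,
        ht2.trans_le (min_le_left _ _), ht3⟩
    · obtain ⟨t, ht1, ht2⟩ := exists_between (lt_min (h1 ▸ h.lt g) (h.lt e))
      refine ⟨t, ht1, ht2.trans_le (min_le_right _ _), h1 ▸ ht1,
        ht2.trans_le (min_le_left _ _), ?_⟩
      simp only [edgeHeight, h1]
      nlinarith
    · rw [← edgeHeight_left (X := X) (Y := Y) (l := l) (r := r) g] at h3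
      obtain ⟨t, ht1, ht2, ht3⟩ := exists_gt_height_lt (lt_min h2 (h.lt g)) h3
      exact ⟨t, h1.trans ht1, ht2.trans_le (min_le_left _ _), ht1,
        ht2.trans_le (min_le_right _ _), ht3⟩
  · rintro ⟨t, h1, h2, h3, h4, h5⟩
    rcases lt_trichotomy (X (l g)) (X (l e)) with h6 | h6 | h6
    · refine Or.inl ⟨h6, h1.trans h4, ?_⟩
      rw [← edgeHeight_left (X := X) (Y := Y) (l := l) (r := r) e]
      exact h.height_lt_of_lt hne le_rfl h6.le h6.ne' h1 h2 h4 h5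
    · have h7 := h.inj h6
      refine Or.inr (Or.inl ⟨h7, ?_⟩)
      simp only [edgeHeight, h7] at h5
      have h8 := sub_pos.2 h1
      by_contra! hle
      nlinarith
    · refine Or.inr (Or.inr ⟨h6, h3.trans h2, ?_⟩)
      rw [← edgeHeight_left (X := X) (Y := Y) (l := l) (r := r) g]
      exact h.height_lt_of_lt hne h6.le le_rfl h6.ne h3 h2 h4 h5

theorem IsLayout.edgeSlope_ne (h : IsLayout X Y l r) {g e : E} (hne : g ≠ e) (hl : l g = l e) :
    edgeSlope X Y l r g ≠ edgeSlope X Y l r e := by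
  intro hs
  obtain ⟨t, ht1, ht2⟩ := exists_between (lt_min (h.lt g) (hl ▸ h.lt e))
  have h1 := ht2.trans_le (min_le_left _ _)
  have h2 := ht2.trans_le (min_le_right _ _)
  obtain ⟨w, hw1, hw2, hw3⟩ := h.planar g e hne t ht1.le h1.le (hl ▸ ht1.le) h2.le
    (by simp only [edgeHeight, hl, hs])
  rcases hw1 with rfl | rfl
  · exact ht1.ne' hw3
  · exact h1.ne hw3

variable [Fintype V] [Fintype E]

open scoped Classical in
/-- The total flow, from left to right, of the edges running below `v`. -/
noncomputable def flowBelow (X Y : V → ℝ) (l r : E → V) (F : E → ℝ) (v : V) : ℝ :=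
  ∑ g, if RunsBelow X Y l r g v then F g else 0

open scoped Classical in
theorem IsLayout.flow_left (h : IsLayout X Y l r) (F : E → ℝ) (e : E) :
    flowBelow X Y l r F (l e) +
      (∑ g, if l g = l e ∧ edgeSlope X Y l r g < edgeSlope X Y l r e then F g else 0) +
      (∑ v with LiesBelow X Y l r e v, ∑ g with l g = v, F g) =
    ∑ g, if IsUnder X Y l r g e then F g else 0 := by
  have h1 : (∑ v with LiesBelow X Y l r e v, ∑ g with l g = v, F g) =
      ∑ g, if LiesBelow X Y l r e (l g) then F g else 0 := by
    have h2 : ∀ v, (if LiesBelow X Y l r e v then ∑ g, if l g = v then F g else 0 else 0) =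
        ∑ g, if l g = v then (if LiesBelow X Y l r e (l g) then F g else 0) else 0 := by
      intro v
      split_ifs with hv
      · refine Finset.sum_congr rfl fun g _ => ?_
        split_ifs <;> simp_all
      · refine (Finset.sum_eq_zero fun g _ => ?_).symm
        split_ifs <;> simp_all
    simp only [Finset.sum_filter, h2]
    rw [Finset.sum_comm]
    simp only [Finset.sum_ite_eq, Finset.mem_univ, if_true]
  rw [h1, flowBelow, ← Finset.sum_add_distrib, ← Finset.sum_add_distrib]
  refine Finset.sum_congr rfl fun g _ => ?_
  by_cases hge : g = e
  · subst hge
    simp [RunsBelow, LiesBelow, IsUnder]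
  · rw [if_congr (h.left_iff hge).symm rfl rfl]
    have e1 : RunsBelow X Y l r g (l e) → ¬ (l g = l e) := fun h1 h2 => by
      have := h1.1
      rw [h2] at this
      exact lt_irrefl _ this
    have e2 : RunsBelow X Y l r g (l e) → ¬ LiesBelow X Y l r e (l g) := fun h1 h2 =>
      lt_asymm h1.1 h2.1
    have e3 : LiesBelow X Y l r e (l g) → ¬ (l g = l e) := fun h1 h2 => by
      have := h1.1
      rw [h2] at this
      exact lt_irrefl _ this
    split_ifs <;> first | (exfalso; tauto) | simp

open scoped Classical in
theorem IsLayout.flow_eq (h : IsLayout X Y l r) (F : E → ℝ)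
    (hF : ∀ v, (∑ g with l g = v, F g) = ∑ g with r g = v, F g) (e : E) :
    flowBelow X Y l r F (l e) +
      (∑ g, if l g = l e ∧ edgeSlope X Y l r g < edgeSlope X Y l r e then F g else 0) =
    flowBelow X Y l r F (r e) +
      (∑ g, if r g = r e ∧ edgeSlope X Y l r e < edgeSlope X Y l r g then F g else 0) := by
  have h1 := h.flow_left F e
  have h2 := h.mirror.flow_left F e
  simp only [flowBelow, h.runsBelow_mirror, h.liesBelow_mirror, h.isUnder_mirror,
    edgeSlope_mirror, neg_lt_neg_iff, ← hF] at h1 h2 ⊢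
  linarith

end Layout

section CyclicOrder

variable {E W K : Type} [Fintype E] [LinearOrder K]

/-- `y` follows `x` in the cyclic order, given by the keys `k`, of the fiber of `π` through `x`. -/
def IsNext (π : E → W) (k : E → K) (x y : E) : Prop :=
  π y = π x ∧ ((k x < k y ∧ ∀ z, π z = π x → k z ≤ k x ∨ k y ≤ k z) ∨
    ∀ z, π z = π x → k z ≤ k x ∧ k y ≤ k z)

theorem exists_isNext (π : E → W) (k : E → K) (x : E) : ∃ y, IsNext π k x y := by
  classical
  by_cases h : ∃ y, π y = π x ∧ k x < k y
  · obtain ⟨y, hy, hmin⟩ := Finset.exists_min_image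
      (Finset.univ.filter fun y => π y = π x ∧ k x < k y) k
      (by obtain ⟨y, hy⟩ := h; exact ⟨y, by simpa using hy⟩)
    simp only [Finset.mem_filter, Finset.mem_univ, true_and] at hy hmin
    refine ⟨y, hy.1, Or.inl ⟨hy.2, fun z hz => ?_⟩⟩
    rcases le_or_gt (k z) (k x) with h1 | h1
    · exact Or.inl h1
    · exact Or.inr (hmin z ⟨hz, h1⟩)
  · push Not at h
    obtain ⟨y, hy, hmin⟩ := Finset.exists_min_image
      (Finset.univ.filter fun y => π y = π x) k ⟨x, by simp⟩
    simp only [Finset.mem_filter, Finset.mem_univ, true_and] at hy hmin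
    exact ⟨y, hy, Or.inr fun z hz => ⟨h z hz, hmin z hz⟩⟩

theorem exists_rotation (π : E → W) (k : E → K)
    (hk : ∀ x y, π x = π y → k x = k y → x = y) :
    ∃ ρ : Perm E, (∀ x, IsNext π k x (ρ x)) ∧ ∀ x y, ρ.SameCycle x y ↔ π x = π y := by
  classical
  choose f hf using exists_isNext π k
  have aux : ∀ x y, π x = π y → f x = f y → ¬ k x < k y := by
    intro x y hxy hfxy hlt
    have h1 := (hf x).2
    have h2 := (hf y).2
    rw [← hfxy, ← hxy] at h2
    rcases h1 with ⟨h3, h4⟩ | h3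
    · rcases h2 with ⟨h5, -⟩ | h5
      · rcases h4 y hxy.symm with h6 | h6
        · exact absurd hlt (not_lt.2 h6)
        · exact absurd h5 (not_lt.2 h6)
      · exact absurd h3 (not_lt.2 (h5 x rfl).2)
    · exact absurd hlt (not_lt.2 (h3 y hxy.symm).1)
  have hinj : Function.Injective f := by
    intro x y hxy
    have hπ : π x = π y := by rw [← (hf x).1, ← (hf y).1, hxy]
    exact hk x y hπ (le_antisymm (not_lt.1 (aux y x hπ.symm hxy.symm)) (not_lt.1 (aux x y hπ hxy)))
  set ρ : Perm E := Equiv.ofBijective f (Finite.injective_iff_bijective.1 hinj) with hρ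
  refine ⟨ρ, hf, fun x y => ⟨fun h => ?_, fun h => ?_⟩⟩
  · exact sameCycle_induction (P := fun y => π x = π y) h rfl
      fun z _ hz => hz.trans (hf z).1.symm
  · have hmax : ∀ x, ∃ z, ρ.SameCycle x z ∧ π z = π x ∧ ∀ y, π y = π x → k y ≤ k z := by
      intro x
      obtain ⟨z, hz, hzmax⟩ := Finset.exists_max_image
        (Finset.univ.filter fun z => ρ.SameCycle x z ∧ π z = π x) k
        ⟨x, by simp [Perm.SameCycle.refl]⟩
      simp only [Finset.mem_filter, Finset.mem_univ, true_and] at hz hzmax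
      refine ⟨z, hz.1, hz.2, ?_⟩
      rcases hf z with ⟨h1, ⟨h2, -⟩ | h2⟩
      · refine absurd h2 (not_lt.2 (hzmax (f z) ⟨?_, h1.trans hz.2⟩))
        exact Perm.sameCycle_apply_right.2 hz.1
      · intro y hy
        exact (h2 y (hy.trans hz.2.symm)).1
    obtain ⟨u, hu1, hu2, hu3⟩ := hmax x
    obtain ⟨v, hv1, hv2, hv3⟩ := hmax y
    have huv : u = v := by
      have hπ : π u = π v := by rw [hu2, hv2, h]
      exact hk u v hπ (le_antisymm (hv3 u (hu2.trans h)) (hu3 v (hv2.trans h.symm)))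
    exact hu1.trans (huv ▸ hv1.symm)

open scoped Classical in
/-- The sum of `f` over the predecessors of `x` in its fiber. -/
noncomputable def partialSum (π : E → W) (k : E → K) (f : E → ℝ) (x : E) : ℝ :=
  ∑ g, if π g = π x ∧ k g < k x then f g else 0

open scoped Classical in
theorem partialSum_next {π : E → W} {k : E → K} (hk : ∀ x y, π x = π y → k x = k y → x = y)
    {f : E → ℝ} (hf : ∀ w, (∑ g, if π g = w then f g else 0) = 0) {x y : E}
    (h : IsNext π k x y) : partialSum π k f y = partialSum π k f x + f x := by
  have h1 : partialSum π k f x + f x = ∑ g, if π g = π x ∧ k g ≤ k x then f g else 0 := by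
    have h2 : f x = ∑ g, if g = x then f g else 0 := by simp
    rw [partialSum, h2, ← Finset.sum_add_distrib]
    refine Finset.sum_congr rfl fun g _ => ?_
    by_cases hgx : g = x
    · subst hgx
      simp
    · have : π g = π x ∧ k g ≤ k x ↔ π g = π x ∧ k g < k x := by
        refine and_congr_right fun h3 => ⟨fun h4 => lt_of_le_of_ne h4 fun h5 => ?_, le_of_lt⟩
        exact hgx (hk g x h3 h5)
      simp only [this, hgx, if_false, add_zero]
  rw [h1, partialSum]
  obtain ⟨h2, ⟨h3, h4⟩ | h3⟩ := h
  · refine Finset.sum_congr rfl fun g _ => if_congr ?_ rfl rfl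
    rw [h2]
    refine and_congr_right fun h5 => ⟨fun h6 => ?_, fun h6 => h6.trans_lt h3⟩
    exact (h4 g h5).resolve_right (not_le.2 h6)
  · have h4 : ∀ g, (if π g = π y ∧ k g < k y then f g else 0) = 0 := fun g =>
      if_neg fun h5 => absurd h5.2 (not_lt.2 (h3 g (h5.1.trans h2)).2)
    simp only [h4, Finset.sum_const_zero]
    refine (hf (π x)).symm.trans ?_
    refine Finset.sum_congr rfl fun g _ => if_congr ?_ rfl rfl
    exact ⟨fun h5 => ⟨h5, (h3 g h5).1⟩, fun h5 => h5.1⟩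

open scoped Classical in
theorem IsCob.sum_fiber_eq_zero {ρ : Perm E} {f : E → ℝ} (h : IsCob ρ f) {π : E → W}
    (hπ : ∀ x, π (ρ x) = π x) (w : W) : (∑ g, if π g = w then f g else 0) = 0 := by
  obtain ⟨T, hT⟩ := h
  have h1 : ∀ g, (if π g = w then f g else 0) =
      (if π g = w then T g else 0) - (if π (ρ g) = w then T (ρ g) else 0) := by
    intro g
    rw [hπ, hT]
    split_ifs <;> ring
  simp only [h1, Finset.sum_sub_distrib]
  rw [Equiv.sum_comp ρ fun g => if π g = w then T g else 0, sub_self]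

end CyclicOrder

section LayoutRotation

variable {V E : Type} {X Y : V → ℝ} {l r : E → V}

/-- `π` selects one end of each edge, and the vertices it selects are never the other end of
an edge. -/
structure IsEndChoice (l r π : E → V) : Prop where
  eq_or : ∀ e, π e = l e ∨ π e = r e
  left : ∀ e g, l g = π e → π g = l g
  right : ∀ e g, r g = π e → π g = r g

open scoped Classical in
/-- The key that orders the edges around `π e` counterclockwise, starting from the downward
direction. -/
noncomputable def ccwKey (X Y : V → ℝ) (l r π : E → V) (e : E) : Bool ×ₗ ℝ :=
  toLex (decide (π e = r e), edgeSlope X Y l r e)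

theorem ccwKey_lt_iff {π : E → V} {g e : E} :
    ccwKey X Y l r π g < ccwKey X Y l r π e ↔ (π g ≠ r g ∧ π e = r e) ∨
      ((π g = r g ↔ π e = r e) ∧ edgeSlope X Y l r g < edgeSlope X Y l r e) := by
  classical
  rw [ccwKey, ccwKey, Prod.Lex.toLex_lt_toLex]
  by_cases h1 : π g = r g <;> by_cases h2 : π e = r e <;> simp [h1, h2]

theorem IsLayout.left_ne_right (h : IsLayout X Y l r) (e : E) : l e ≠ r e := fun h1 =>
  (h.lt e).ne (congrArg X h1)

theorem IsLayout.edgeSlope_ne_right (h : IsLayout X Y l r) {g e : E} (hne : g ≠ e)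
    (hr : r g = r e) : edgeSlope X Y l r g ≠ edgeSlope X Y l r e := by
  have := h.mirror.edgeSlope_ne hne hr
  simpa only [edgeSlope_mirror, ne_eq, neg_inj] using this

theorem IsLayout.ccwKey_injOn (h : IsLayout X Y l r) {π : E → V} (hπ : IsEndChoice l r π)
    (x y : E) (hxy : π x = π y) (hk : ccwKey X Y l r π x = ccwKey X Y l r π y) : x = y := by
  by_contra hne
  simp only [ccwKey, toLex_inj, Prod.mk.injEq, decide_eq_decide] at hk
  obtain ⟨h1, h2⟩ := hk
  by_cases h3 : π x = r x
  · exact h.edgeSlope_ne_right hne (by rw [← h3, hxy, h1.1 h3]) h2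
  · have h4 := (hπ.eq_or x).resolve_right h3
    have h5 := (hπ.eq_or y).resolve_right fun h6 => h3 (h1.2 h6)
    exact h.edgeSlope_ne hne (by rw [← h4, hxy, h5]) h2

variable [Fintype V] [Fintype E]

open scoped Classical in
theorem IsLayout.flowBelow_add_partialSum (h : IsLayout X Y l r) {π : E → V}
    (hπ : IsEndChoice l r π) {f F : E → ℝ} (hF : ∀ e, F e = if π e = l e then f e else - f e)
    (hcons : ∀ v, (∑ g with l g = v, F g) = ∑ g with r g = v, F g)
    (hf : ∀ v, (∑ g, if π g = v then f g else 0) = 0) (e : E) :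
    flowBelow X Y l r F (π e) + partialSum π (ccwKey X Y l r π) f e =
      flowBelow X Y l r F (l e) +
        (∑ g, if l g = l e ∧ edgeSlope X Y l r g < edgeSlope X Y l r e then F g else 0) -
          if π e = l e then 0 else f e := by
  by_cases he : π e = l e
  · rw [if_pos he, sub_zero, he, partialSum]
    congr 1
    refine Finset.sum_congr rfl fun g _ => ?_
    have hr : π e ≠ r e := fun h1 => h.left_ne_right e (he.symm.trans h1)
    have : (π g = π e ∧ ccwKey X Y l r π g < ccwKey X Y l r π e) ↔
        (l g = l e ∧ edgeSlope X Y l r g < edgeSlope X Y l r e) := by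
      simp only [ccwKey_lt_iff, hr, and_false, false_or, iff_false]
      constructor
      · rintro ⟨h1, h2, h3⟩
        have h4 := (hπ.eq_or g).resolve_right h2
        exact ⟨by rw [← h4, h1, he], h3⟩
      · rintro ⟨h1, h2⟩
        have h3 := hπ.left e g (h1.trans he.symm)
        have h4 : π g ≠ r g := fun h4 => h.left_ne_right g (h3.symm.trans h4)
        exact ⟨by rw [h3, h1, he], h4, h2⟩
    by_cases hg : l g = l e ∧ edgeSlope X Y l r g < edgeSlope X Y l r e
    · rw [if_pos hg, if_pos (this.2 hg), hF, if_pos (hπ.left e g (hg.1.trans he.symm))]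
    · rw [if_neg hg, if_neg fun h1 => hg (this.1 h1)]
  · have her := (hπ.eq_or e).resolve_left he
    rw [if_neg he, h.flow_eq F hcons e, her, partialSum]
    have h1 : ∀ g, (if π g = π e ∧ ccwKey X Y l r π g < ccwKey X Y l r π e then f g else 0) =
        (if π g = π e then f g else 0) +
          (if r g = r e ∧ edgeSlope X Y l r e < edgeSlope X Y l r g then F g else 0) +
          (if g = e then F g else 0) := by
      intro g
      by_cases hge : g = e
      · subst hge
        simp [hF, he]
      rw [if_neg hge, add_zero]
      by_cases hg : π g = π e
      · have h6 : (π g = π e ∧ ccwKey X Y l r π g < ccwKey X Y l r π e) ↔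
            (π g ≠ r g ∨ edgeSlope X Y l r g < edgeSlope X Y l r e) := by
          simp only [ccwKey_lt_iff, hg, true_and, her, and_true, iff_true]
          tauto
        rw [if_congr h6 rfl rfl, if_pos hg, ← her]
        by_cases hgl : π g = l g
        · have h2 : r g ≠ π e := fun h2 => h.left_ne_right g (by rw [← hgl, hπ.right e g h2])
          have h3 : π g ≠ r g := fun h3 => h2 (by rw [← h3, hg])
          simp [h2, h3]
        · have hgr := (hπ.eq_or g).resolve_left hgl
          have h2 : r g = π e := by rw [← hgr, hg]
          have h4 : edgeSlope X Y l r g ≠ edgeSlope X Y l r e :=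
            h.edgeSlope_ne_right hge (h2.trans her)
          rcases lt_or_gt_of_ne h4 with h5 | h5
          · simp [h2, hgr, h5, h5.not_gt]
          · have h7 : F g = - f g := by rw [hF, if_neg hgl]
            simp [h2, hgr, h5, h5.not_gt, h7]
      · have h2 : r g ≠ r e := fun h2 => hg (by rw [hπ.right e g (h2.trans her.symm), h2, her])
        simp [hg, h2]
    simp only [h1, Finset.sum_add_distrib, hf, Finset.sum_ite_eq', Finset.mem_univ, if_true,
      hF e, if_neg he]
    ring

theorem exists_rotation_system {a b : E → V} {p : V → ℝ × ℝ}
    (hp : Function.Injective fun v => (p v).1) (hab : ∀ e f, a e ≠ b f)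
    (hpar : ∀ e f, a e = a f → b e = b f → e = f)
    (hplanar : ∀ e f, e ≠ f → ∀ q ∈ segment ℝ (p (a e)) (p (b e)),
      q ∈ segment ℝ (p (a f)) (p (b f)) →
      ∃ w, (w = a e ∨ w = b e) ∧ (w = a f ∨ w = b f) ∧ q = p w) :
    ∃ σ τ : Perm E, (∀ e f, σ.SameCycle e f ↔ a e = a f) ∧ (∀ e f, τ.SameCycle e f ↔ b e = b f) ∧
      HasPotentials σ τ ∧ Bundled σ τ := by
  classical
  set X : V → ℝ := fun v => (p v).1 with hX
  set Y : V → ℝ := fun v => (p v).2 with hY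
  set l : E → V := fun e => if X (a e) < X (b e) then a e else b e with hl
  set r : E → V := fun e => if X (a e) < X (b e) then b e else a e with hr
  have hlr : ∀ e, (l e = a e ∧ r e = b e) ∨ (l e = b e ∧ r e = a e) := by
    intro e
    simp only [hl, hr]
    split_ifs <;> simp
  have hlt : ∀ e, X (l e) < X (r e) := by
    intro e
    simp only [hl, hr]
    split_ifs with h1
    · exact h1
    · exact lt_of_le_of_ne (not_lt.1 h1) fun h2 => hab e e (hp h2).symm
  clear_value l r
  have hmem : ∀ e t, X (l e) ≤ t → t ≤ X (r e) →
      (t, edgeHeight X Y l r e t) ∈ segment ℝ (p (a e)) (p (b e)) := by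
    intro e t h1 h2
    have h3 : (t, edgeHeight X Y l r e t) ∈ segment ℝ (p (l e)) (p (r e)) := by
      have hpos := sub_pos.2 (hlt e)
      refine ⟨(X (r e) - t) / (X (r e) - X (l e)), (t - X (l e)) / (X (r e) - X (l e)),
        div_nonneg (by linarith) hpos.le, div_nonneg (by linarith) hpos.le, ?_, ?_⟩
      · field_simp
        ring
      · ext
        · simp only [Prod.fst_add, Prod.smul_fst, smul_eq_mul]
          change _ * X (l e) + _ * X (r e) = t
          field_simp
          ring
        · simp only [Prod.snd_add, Prod.smul_snd, smul_eq_mul, edgeHeight, edgeSlope]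
          change _ * Y (l e) + _ * Y (r e) = _
          field_simp
          ring
    rcases hlr e with ⟨h4, h5⟩ | ⟨h4, h5⟩
    · rwa [h4, h5] at h3
    · rwa [h4, h5, segment_symm] at h3
  have hends : ∀ e w, (w = a e ∨ w = b e) → (w = l e ∨ w = r e) := by
    intro e w hw
    rcases hlr e with ⟨h4, h5⟩ | ⟨h4, h5⟩ <;> rw [h4, h5] <;> tauto
  have h : IsLayout X Y l r := by
    refine ⟨hp, hlt, fun e g hne t h1 h2 h3 h4 h5 => ?_⟩
    have h6 := hmem g t h3 h4
    rw [← h5] at h6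
    obtain ⟨w, hw1, hw2, hw3⟩ := hplanar e g hne _ (hmem e t h1 h2) h6
    exact ⟨w, hends e w hw1, hends g w hw2, congrArg Prod.fst hw3⟩
  have hca : IsEndChoice l r a := by
    refine ⟨fun e => ?_, fun e g h1 => ?_, fun e g h1 => ?_⟩
    · rcases hlr e with ⟨h4, h5⟩ | ⟨h4, h5⟩ <;> simp [h4, h5]
    · rcases hlr g with ⟨h4, h5⟩ | ⟨h4, h5⟩
      · exact h4.symm
      · exact absurd (h4.symm.trans h1) (hab _ _).symm
    · rcases hlr g with ⟨h4, h5⟩ | ⟨h4, h5⟩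
      · exact absurd (h5.symm.trans h1) (hab _ _).symm
      · exact h5.symm
  have hcb : IsEndChoice l r b := by
    refine ⟨fun e => ?_, fun e g h1 => ?_, fun e g h1 => ?_⟩
    · rcases hlr e with ⟨h4, h5⟩ | ⟨h4, h5⟩ <;> simp [h4, h5]
    · rcases hlr g with ⟨h4, h5⟩ | ⟨h4, h5⟩
      · exact absurd (h4.symm.trans h1) (hab _ _)
      · exact h4.symm
    · rcases hlr g with ⟨h4, h5⟩ | ⟨h4, h5⟩
      · exact h5.symm
      · exact absurd (h5.symm.trans h1) (hab _ _)
  have hka := h.ccwKey_injOn hca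
  have hkb := h.ccwKey_injOn hcb
  obtain ⟨σ, hσ, hσ'⟩ := exists_rotation a (ccwKey X Y l r a) hka
  obtain ⟨τ, hτ, hτ'⟩ := exists_rotation b (ccwKey X Y l r b) hkb
  refine ⟨σ, τ, hσ', hτ', fun f hfσ hfτ => ?_, fun x y hx hy => ?_⟩
  · have hfa := hfσ.sum_fiber_eq_zero (π := a) fun x => (hσ x).1
    have hfb := hfτ.neg.sum_fiber_eq_zero (π := b) fun x => (hτ x).1
    set F : E → ℝ := fun e => if a e = l e then f e else - f e with hF
    have hFb : ∀ e, F e = if b e = l e then - f e else - (- f e) := by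
      intro e
      simp only [hF]
      rcases hlr e with ⟨h4, -⟩ | ⟨h4, -⟩ <;> simp [h4, hab e e, (hab e e).symm]
    have hcons : ∀ v, (∑ g with l g = v, F g) = ∑ g with r g = v, F g := by
      intro v
      have h1 : ∀ g, (if l g = v then F g else 0) - (if r g = v then F g else 0) =
          (if a g = v then f g else 0) + (if b g = v then - f g else 0) := by
        intro g
        simp only [hF]
        rcases hlr g with ⟨h4, h5⟩ | ⟨h4, h5⟩
        · rw [h4, h5, if_pos rfl]
          split_ifs <;> ring
        · rw [h4, h5, if_neg (hab g g)]
          split_ifs <;> ring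
      rw [← sub_eq_zero, Finset.sum_filter, Finset.sum_filter, ← Finset.sum_sub_distrib]
      simp only [h1, Finset.sum_add_distrib, hfa, hfb, add_zero]
    have hLa := h.flowBelow_add_partialSum hca (f := f) (fun _ => rfl) hcons hfa
    have hLb := h.flowBelow_add_partialSum hcb hFb hcons hfb
    set L : E → ℝ := fun e => flowBelow X Y l r F (a e) +
      partialSum a (ccwKey X Y l r a) f e + f e with hL
    have hL' : ∀ e, L e = flowBelow X Y l r F (b e) +
        partialSum b (ccwKey X Y l r b) (fun x => - f x) e := by
      intro e
      simp only [hL]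
      rw [hLa, hLb]
      rcases hlr e with ⟨h4, -⟩ | ⟨h4, -⟩
      · rw [h4, if_pos rfl, if_neg (hab e e).symm]
        ring
      · rw [h4, if_pos rfl, if_neg (hab e e)]
        ring
    refine ⟨L, fun x => ?_, fun x => ?_⟩
    · simp only [hL]
      rw [(hσ x).1, partialSum_next hka hfa (hσ x)]
      ring
    · rw [hL', hL', (hτ x).1, partialSum_next hkb hfb (hτ x)]
      ring
  · rw [hpar x y ((hσ' x y).1 hx) ((hτ' x y).1 hy)]
    exact Or.inl .refl

end LayoutRotation

section Assembly

/-- A generic shear gives finitely many points distinct abscissae. -/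
theorem exists_shear {V : Type} [Finite V] {p : V → ℝ × ℝ} (hp : Function.Injective p) :
    ∃ δ : ℝ, Function.Injective fun v => (p v).1 + δ * (p v).2 := by
  obtain ⟨δ, hδ⟩ := (Set.finite_range fun w : V × V =>
    ((p w.2).1 - (p w.1).1) / ((p w.1).2 - (p w.2).2)).exists_notMem
  refine ⟨δ, fun u v huv => ?_⟩
  simp only at huv
  by_cases h : (p u).2 = (p v).2
  · rw [h] at huv
    exact hp (Prod.ext (by linarith) h)
  · refine absurd ⟨(u, v), ?_⟩ hδ
    have h1 := sub_ne_zero.2 h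
    simp only
    field_simp
    linarith

theorem mem_segment_of_shear {δ : ℝ} {a b q : ℝ × ℝ}
    (h : q ∈ segment ℝ (a.1 + δ * a.2, a.2) (b.1 + δ * b.2, b.2)) :
    (q.1 - δ * q.2, q.2) ∈ segment ℝ a b := by
  obtain ⟨s, t, hs, ht, hst, rfl⟩ := h
  refine ⟨s, t, hs, ht, hst, ?_⟩
  ext
  · simp only [Prod.fst_add, Prod.smul_fst, Prod.snd_add, Prod.smul_snd, smul_eq_mul]
    ring
  · rfl

theorem fst_le_of_mem_segment {a b q : ℝ × ℝ} {M : ℝ} (ha : a.1 ≤ M) (hb : b.1 ≤ M)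
    (h : q ∈ segment ℝ a b) : q.1 ≤ M := by
  obtain ⟨s, t, hs, ht, hst, rfl⟩ := h
  simp only [Prod.fst_add, Prod.smul_fst, smul_eq_mul]
  calc s * a.1 + t * b.1 ≤ s * M + t * M := by gcongr
    _ = M := by rw [← add_mul, hst, one_mul]

variable {A B : Type} {G : SimpleGraph (A ⊕ B)}

/-- The edges of a bipartite graph as pairs of vertices. -/
abbrev EdgePair (G : SimpleGraph (A ⊕ B)) : Type :=
  {e : A × B // G.Adj (Sum.inl e.1) (Sum.inr e.2)}

theorem exists_edgePair (hA : ∀ a a' : A, ¬ G.Adj (Sum.inl a) (Sum.inl a'))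
    (hB : ∀ b b' : B, ¬ G.Adj (Sum.inr b) (Sum.inr b')) {e : Sym2 (A ⊕ B)} (he : e ∈ G.edgeSet) :
    ∃ f : EdgePair G, e = s(Sum.inl f.1.1, Sum.inr f.1.2) := by
  induction e using Sym2.ind with
  | _ u v =>
    rw [SimpleGraph.mem_edgeSet] at he
    rcases u with a | b <;> rcases v with a' | b'
    · exact absurd he (hA _ _)
    · exact ⟨⟨(a, b'), he⟩, rfl⟩
    · exact ⟨⟨(a', b), he.symm⟩, Sym2.eq_swap⟩
    · exact absurd he (hB _ _)

theorem exists_isHHDrawing_of_straightDrawing [Finite A] [Finite B] (Γ : StraightDrawing G)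
    (hΓ : Γ.IsPlanar) : ∃ (σ τ : Perm (EdgePair G)) (pA pB : EdgePair G → ℝ × ℝ),
      (∀ e f, σ.SameCycle e f ↔ e.1.1 = f.1.1) ∧ (∀ e f, τ.SameCycle e f ↔ e.1.2 = f.1.2) ∧
      IsHHDrawing σ τ pA pB := by
  classical
  have := Fintype.ofFinite A
  have := Fintype.ofFinite B
  obtain ⟨δ, hδ⟩ := exists_shear Γ.pos_inj
  obtain ⟨σ, τ, hσ, hτ, hP, hB⟩ := exists_rotation_system
    (a := fun e : EdgePair G => (Sum.inl e.1.1 : A ⊕ B))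
    (b := fun e : EdgePair G => (Sum.inr e.1.2 : A ⊕ B))
    (p := fun v => ((Γ.pos v).1 + δ * (Γ.pos v).2, (Γ.pos v).2)) hδ
    (fun _ _ => Sum.inl_ne_inr)
    (fun e f h1 h2 => Subtype.ext (Prod.ext (Sum.inl_injective h1) (Sum.inr_injective h2)))
    (by
      intro e f hef q hqe hqf
      have hne : s((Sum.inl e.1.1 : A ⊕ B), Sum.inr e.1.2) ≠ s(Sum.inl f.1.1, Sum.inr f.1.2) := by
        intro h
        rw [Sym2.eq_iff] at h
        rcases h with ⟨h1, h2⟩ | ⟨h1, -⟩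
        · exact hef (Subtype.ext (Prod.ext (Sum.inl_injective h1) (Sum.inr_injective h2)))
        · exact Sum.inl_ne_inr h1
      obtain ⟨w, hw1, hw2, hw3⟩ := hΓ.2 _ (G.mem_edgeSet.2 e.2) _ (G.mem_edgeSet.2 f.2) hne _
        ⟨mem_segment_of_shear hqe, mem_segment_of_shear hqf⟩
      refine ⟨w, Sym2.mem_iff.1 hw1, Sym2.mem_iff.1 hw2, ?_⟩
      rw [← hw3]
      simp)
  obtain ⟨pA, pB, h⟩ := exists_isHHDrawing _ σ τ rfl hP hB
  exact ⟨σ, τ, pA, pB, fun e f => (hσ e f).trans Sum.inl_injective.eq_iff,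
    fun e f => (hτ e f).trans Sum.inr_injective.eq_iff, h⟩

/-- Isolated vertices can be placed far to the right of all edges. -/
theorem exists_positions [Finite A] [Finite B] {σ τ : Perm (EdgePair G)}
    {pA pB : EdgePair G → ℝ × ℝ} (hσ : ∀ e f, σ.SameCycle e f ↔ e.1.1 = f.1.1)
    (hτ : ∀ e f, τ.SameCycle e f ↔ e.1.2 = f.1.2) (h : IsHHDrawing σ τ pA pB) :
    ∃ (M : ℝ) (pos : A ⊕ B → ℝ × ℝ),
      (∀ e, (pA e).1 ≤ M) ∧ (∀ e, (pB e).1 ≤ M) ∧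
      (∀ e : EdgePair G, pos (Sum.inl e.1.1) = pA e) ∧
      (∀ e : EdgePair G, pos (Sum.inr e.1.2) = pB e) ∧
      (∀ a, 0 < (pos (Sum.inl a)).2) ∧ (∀ b, (pos (Sum.inr b)).2 < 0) ∧
      (∀ a, (∃ e : EdgePair G, e.1.1 = a) ∨ M < (pos (Sum.inl a)).1) ∧
      (∀ b, (∃ e : EdgePair G, e.1.2 = b) ∨ M < (pos (Sum.inr b)).1) ∧
      ∀ u v, M < (pos u).1 → (pos u).1 = (pos v).1 → u = v := by
  classical
  obtain ⟨MA, hMA⟩ := (Set.finite_range fun e => (pA e).1).bddAbove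
  obtain ⟨MB, hMB⟩ := (Set.finite_range fun e => (pB e).1).bddAbove
  set M := max MA MB with hM
  have hA : ∀ e, (pA e).1 ≤ M := fun e => (hMA ⟨e, rfl⟩).trans (le_max_left _ _)
  have hB : ∀ e, (pB e).1 ≤ M := fun e => (hMB ⟨e, rfl⟩).trans (le_max_right _ _)
  obtain ⟨n, ⟨φ⟩⟩ := Finite.exists_equiv_fin (A ⊕ B)
  set k : A ⊕ B → ℝ := fun v => M + 1 + ((φ v : ℕ) : ℝ) with hk
  have hkM : ∀ v, M < k v := fun v => by
    have : (0 : ℝ) ≤ ((φ v : ℕ) : ℝ) := Nat.cast_nonneg _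
    simp only [hk]
    linarith
  have hkinj : Function.Injective k := fun u v huv => by
    simp only [hk, add_right_inj, Nat.cast_inj, Fin.val_inj, φ.apply_eq_iff_eq] at huv
    exact huv
  have hexA : ∀ a : A, ∃ q : ℝ × ℝ, 0 < q.2 ∧ (∀ e : EdgePair G, e.1.1 = a → q = pA e) ∧
      ((∃ e : EdgePair G, e.1.1 = a ∧ q.1 ≤ M) ∨ q.1 = k (Sum.inl a)) := by
    intro a
    by_cases ha : ∃ e : EdgePair G, e.1.1 = a
    · obtain ⟨e, he⟩ := ha
      exact ⟨pA e, h.top_pos e, fun f hf => h.top_eq ((hσ f e).2 (hf.trans he.symm)),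
        Or.inl ⟨e, he, hA e⟩⟩
    · exact ⟨(k (Sum.inl a), 1), one_pos, fun f hf => absurd ⟨f, hf⟩ ha, Or.inr rfl⟩
  have hexB : ∀ b : B, ∃ q : ℝ × ℝ, q.2 < 0 ∧ (∀ e : EdgePair G, e.1.2 = b → q = pB e) ∧
      ((∃ e : EdgePair G, e.1.2 = b ∧ q.1 ≤ M) ∨ q.1 = k (Sum.inr b)) := by
    intro b
    by_cases hb : ∃ e : EdgePair G, e.1.2 = b
    · obtain ⟨e, he⟩ := hb
      exact ⟨pB e, h.bottom_neg e, fun f hf => h.bottom_eq ((hτ f e).2 (hf.trans he.symm)),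
        Or.inl ⟨e, he, hB e⟩⟩
    · exact ⟨(k (Sum.inr b), -1), neg_one_lt_zero, fun f hf => absurd ⟨f, hf⟩ hb, Or.inr rfl⟩
  choose qA hqA1 hqA2 hqA3 using hexA
  choose qB hqB1 hqB2 hqB3 using hexB
  set pos : A ⊕ B → ℝ × ℝ := Sum.elim qA qB with hpos
  have hpos : ∀ v, (pos v).1 ≤ M ∨ (pos v).1 = k v := by
    rintro (a | b)
    · exact (hqA3 a).imp (fun ⟨_, _, h⟩ => h) id
    · exact (hqB3 b).imp (fun ⟨_, _, h⟩ => h) id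
  refine ⟨M, pos, hA, hB, fun e => hqA2 _ e rfl, fun e => hqB2 _ e rfl, hqA1, hqB1,
    fun a => (hqA3 a).imp (fun ⟨e, he, _⟩ => ⟨e, he⟩) fun h1 => ?_,
    fun b => (hqB3 b).imp (fun ⟨e, he, _⟩ => ⟨e, he⟩) fun h1 => ?_, fun u v hu huv => ?_⟩
  · exact (hkM _).trans_eq h1.symm
  · exact (hkM _).trans_eq h1.symm
  · have h1 := (hpos u).resolve_left (not_le.2 hu)
    have h2 := (hpos v).resolve_left (not_le.2 (huv ▸ hu))
    exact hkinj (by rw [← h1, ← h2, huv])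

end Assembly

end HHDrawing

/-- Every simple bipartite graph (bipartition `A ∪ B`) admitting a
planar straight-line drawing admits a planar straight-line HH-drawing: all vertices of
`A` have positive `y`-coordinate and all vertices of `B` negative `y`-coordinate. -/
theorem stmt13 {A B : Type} [Fintype A] [Fintype B] (G : SimpleGraph (A ⊕ B))
    (hA : ∀ a a' : A, ¬ G.Adj (Sum.inl a) (Sum.inl a'))
    (hB : ∀ b b' : B, ¬ G.Adj (Sum.inr b) (Sum.inr b'))
    (hpl : ∃ Γ : StraightDrawing G, Γ.IsPlanar) :
    ∃ Γ : StraightDrawing G, Γ.IsPlanar ∧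
      (∀ a : A, 0 < (Γ.pos (Sum.inl a)).2) ∧
      (∀ b : B, (Γ.pos (Sum.inr b)).2 < 0) := by
  obtain ⟨Γ, hΓ⟩ := hpl
  obtain ⟨σ, τ, pA, pB, hσ, hτ, h⟩ := HHDrawing.exists_isHHDrawing_of_straightDrawing Γ hΓ
  obtain ⟨M, pos, hMA, hMB, hposA, hposB, hAy, hBy, hAx, hBx, hfar⟩ :=
    HHDrawing.exists_positions hσ hτ h
  have hendA : ∀ e f, pA e ∈ segment ℝ (pA f) (pB f) → e.1.1 = f.1.1 := by
    intro e f hef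
    rcases h.planar e f _ (left_mem_segment _ _ _) hef with h1 | h1 | h1
    · exact (hσ e f).1 h1.1
    · exact absurd h1.2 (h.top_ne_bottom _ _)
    · exact (hσ e f).1 h1.1
  have hendB : ∀ e f, pB e ∈ segment ℝ (pA f) (pB f) → e.1.2 = f.1.2 := by
    intro e f hef
    rcases h.planar e f _ (right_mem_segment _ _ _) hef with h1 | h1 | h1
    · exact absurd h1.2.symm (h.top_ne_bottom _ _)
    · exact (hτ e f).1 h1.1
    · exact (hτ e f).1 h1.2
  have hinj : Function.Injective pos := by
    intro u v huv
    by_cases hu : M < (pos u).1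
    · exact hfar u v hu (by rw [huv])
    have hv : ¬ M < (pos v).1 := huv ▸ hu
    rcases u with a | b <;> rcases v with a' | b'
    · obtain ⟨e, rfl⟩ := (hAx a).resolve_right hu
      obtain ⟨f, rfl⟩ := (hAx a').resolve_right hv
      rw [hposA, hposA] at huv
      rw [hendA e f (huv ▸ left_mem_segment _ _ _)]
    · have h1 := hAy a
      have h2 := hBy b'
      rw [huv] at h1
      exact absurd h1 h2.not_gt
    · have h1 := hAy a'
      have h2 := hBy b
      rw [huv] at h2
      exact absurd h1 h2.not_gt
    · obtain ⟨e, rfl⟩ := (hBx b).resolve_right hu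
      obtain ⟨f, rfl⟩ := (hBx b').resolve_right hv
      rw [hposB, hposB] at huv
      rw [hendB e f (huv ▸ right_mem_segment _ _ _)]
  have hseg : ∀ f : HHDrawing.EdgePair G,
      StraightDrawing.edgePts (G := G) ⟨pos, hinj⟩ s(Sum.inl f.1.1, Sum.inr f.1.2) =
        segment ℝ (pA f) (pB f) := by
    intro f
    change segment ℝ (pos (Sum.inl f.1.1)) (pos (Sum.inr f.1.2)) = _
    rw [hposA, hposB]
  refine ⟨⟨pos, hinj⟩, ⟨fun v e he hv hmem => ?_, fun e he f hf hef q hq => ?_⟩, hAy, hBy⟩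
  · obtain ⟨f, rfl⟩ := HHDrawing.exists_edgePair hA hB he
    rw [hseg] at hmem
    have hle : ¬ M < (pos v).1 :=
      not_lt.2 (HHDrawing.fst_le_of_mem_segment (hMA f) (hMB f) hmem)
    rcases v with a | b
    · obtain ⟨e, rfl⟩ := (hAx a).resolve_right hle
      change pos _ ∈ _ at hmem
      rw [hposA] at hmem
      exact hv (by rw [hendA e f hmem]; exact Sym2.mem_mk_left _ _)
    · obtain ⟨e, rfl⟩ := (hBx b).resolve_right hle
      change pos _ ∈ _ at hmem
      rw [hposB] at hmem
      exact hv (by rw [hendB e f hmem]; exact Sym2.mem_mk_right _ _)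
  · obtain ⟨e, rfl⟩ := HHDrawing.exists_edgePair hA hB he
    obtain ⟨f, rfl⟩ := HHDrawing.exists_edgePair hA hB hf
    rw [hseg, hseg] at hq
    rcases h.planar e f q hq.1 hq.2 with ⟨h1, h2⟩ | ⟨h1, h2⟩ | ⟨h1, h2⟩
    · refine ⟨Sum.inl e.1.1, Sym2.mem_mk_left _ _, ?_, by rw [h2]; exact (hposA e).symm⟩
      rw [(hσ e f).1 h1]
      exact Sym2.mem_mk_left _ _
    · refine ⟨Sum.inr e.1.2, Sym2.mem_mk_right _ _, ?_, by rw [h2]; exact (hposB e).symm⟩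
      rw [(hτ e f).1 h1]
      exact Sym2.mem_mk_right _ _
    · exact absurd (by rw [(hσ e f).1 h1, (hτ e f).1 h2]) hef
end
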